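/- arXiv:2011.00276 — 4 statements merged into one kernel-verified Lean document; each statement's English description precedes it below -/
import Mathlib

section
/- Focusing case on the half-line: let p ∈ (2,6), α > 0 and μ ∈ (0, μ_{ℝ⁺}). Then the NLS energy E_α(·, ℝ⁺) is bounded from below on H¹_μ(ℝ⁺), its infimum ℰ_α(μ, ℝ⁺) is strictly negative, and it is achieved: there exists u ∈ H¹_μ(ℝ⁺) with E_α(u, ℝ⁺) = ℰ_α(μ, ℝ⁺) < 0. -/
open MeasureTheory Real Set Filter

/-- Membership in `H¹(ℝ⁺)`: `u` is continuous on `[0,∞)`, differentiable on `(0,∞)`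
with derivative `u'`, and both `u` and `u'` are square-integrable on `(0,∞)`. -/
def H1halfline (u u' : ℝ → ℝ) : Prop :=
  ContinuousOn u (Set.Ici 0) ∧
  (∀ x ∈ Set.Ioi (0 : ℝ), HasDerivAt u (u' x) x) ∧
  IntegrableOn (fun x => (u x) ^ 2) (Set.Ioi 0) ∧
  IntegrableOn (fun x => (u' x) ^ 2) (Set.Ioi 0)

/-- The NLS energy on the half-line
`E_α(u, ℝ⁺) = ∫₀^∞ (½|u'|² − (1/6)|u|⁶ − (α/p)|u|^p)`. -/
noncomputable def Ehalfline (p α : ℝ) (u u' : ℝ → ℝ) : ℝ :=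
  ∫ x in Set.Ioi (0 : ℝ),
    (1 / 2 * (u' x) ^ 2 - 1 / 6 * |u x| ^ 6 - α / p * |u x| ^ p)

/-- The rescaled gap between the potential at height `1` and at height `t`. -/
noncomputable def solitonGap (p l t : ℝ) : ℝ := (1 - t ^ 4) / 3 + l * (1 - t ^ (p - 2))

/-- The mass of the half-soliton whose rescaled power parameter is `l`. -/
noncomputable def solitonMass (p l : ℝ) : ℝ := ∫ t in (0 : ℝ)..1, t / √(solitonGap p l t)

lemma critical_primitive_hasDerivAt {t : ℝ} (ht : t ∈ Ioo (0 : ℝ) 1) :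
    HasDerivAt (fun t => √3 / 2 * arcsin (t ^ 2)) (t / √((1 - t ^ 4) / 3)) t := by
  obtain ⟨h0, h1⟩ := ht
  have h2 : t ^ 2 < 1 := by nlinarith
  have h := (HasDerivAt.comp (h₂ := arcsin) (h := fun t : ℝ => t ^ 2) t
    (Real.hasDerivAt_arcsin (x := t ^ 2) (by nlinarith) h2.ne)
    (hasDerivAt_pow 2 t)).const_mul (√3 / 2)
  refine h.congr_deriv ?_
  have h4 : 0 < 1 - t ^ 4 := by nlinarith
  rw [Real.sqrt_div h4.le, show 1 - (t ^ 2) ^ 2 = 1 - t ^ 4 by ring]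
  have := Real.sqrt_pos.2 h4
  field_simp
  simp

lemma critical_primitive_continuous : Continuous (fun t : ℝ => √3 / 2 * arcsin (t ^ 2)) := by
  fun_prop

lemma critical_intervalIntegrable :
    IntervalIntegrable (fun t => t / √((1 - t ^ 4) / 3)) volume 0 1 := by
  refine intervalIntegral.intervalIntegrable_deriv_of_nonneg
    critical_primitive_continuous.continuousOn (fun x hx => ?_) (fun x hx => ?_)
  · exact critical_primitive_hasDerivAt (by simpa using hx)
  · have : 0 < x := by simpa using hx.1
    positivity

lemma solitonMass_zero (p : ℝ) : solitonMass p 0 = π * √3 / 4 := by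
  have h := intervalIntegral.integral_eq_sub_of_hasDerivAt_of_le zero_le_one
    critical_primitive_continuous.continuousOn
    (fun x hx => critical_primitive_hasDerivAt hx) critical_intervalIntegrable
  simp only [solitonMass, solitonGap, zero_mul, add_zero]
  rw [h]
  simp
  ring

lemma solitonGap_ge {p l t : ℝ} (hp : 2 < p) (hl : 0 ≤ l) (ht : t ∈ Icc (0 : ℝ) 1) :
    (1 - t ^ 4) / 3 ≤ solitonGap p l t := by
  have : t ^ (p - 2) ≤ 1 := Real.rpow_le_one ht.1 ht.2 (by linarith)
  have := mul_nonneg hl (sub_nonneg.2 this)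
  unfold solitonGap
  linarith

lemma solitonGap_pos {p l t : ℝ} (hp : 2 < p) (hl : 0 ≤ l) (ht : t ∈ Ico (0 : ℝ) 1) :
    0 < solitonGap p l t := by
  have h1 := solitonGap_ge hp hl (Ico_subset_Icc_self ht)
  have : t ^ 4 < 1 := pow_lt_one₀ ht.1 ht.2 (by norm_num)
  linarith

lemma solitonGap_mono {p l l' t : ℝ} (hp : 2 < p) (hl : l ≤ l') (ht : t ∈ Icc (0 : ℝ) 1) :
    solitonGap p l t ≤ solitonGap p l' t := by
  have : t ^ (p - 2) ≤ 1 := Real.rpow_le_one ht.1 ht.2 (by linarith)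
  have := mul_le_mul_of_nonneg_right hl (sub_nonneg.2 this)
  unfold solitonGap
  linarith

lemma measurable_solitonGap (p l : ℝ) : Measurable (solitonGap p l) := by
  unfold solitonGap
  fun_prop

lemma soliton_integrand_le {p l l' t : ℝ} (hp : 2 < p) (hl : 0 ≤ l) (hll : l ≤ l')
    (ht : t ∈ Ioc (0 : ℝ) 1) : t / √(solitonGap p l' t) ≤ t / √(solitonGap p l t) := by
  rcases ht.2.eq_or_lt with rfl | h1
  · simp [solitonGap]
  · have := solitonGap_pos hp hl ⟨ht.1.le, h1⟩
    have h0 := ht.1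
    have := solitonGap_mono hp hll (Ioc_subset_Icc_self ht)
    gcongr

lemma soliton_integrand_le_critical {p l t : ℝ} (hp : 2 < p) (hl : 0 ≤ l)
    (ht : t ∈ Ioc (0 : ℝ) 1) : t / √(solitonGap p l t) ≤ t / √((1 - t ^ 4) / 3) := by
  simpa [solitonGap] using soliton_integrand_le hp le_rfl hl ht

lemma norm_soliton_integrand_le {p l t : ℝ} (hp : 2 < p) (hl : 0 ≤ l)
    (ht : t ∈ Ioc (0 : ℝ) 1) : ‖t / √(solitonGap p l t)‖ ≤ t / √((1 - t ^ 4) / 3) := by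
  rw [Real.norm_of_nonneg (div_nonneg ht.1.le (Real.sqrt_nonneg _))]
  exact soliton_integrand_le_critical hp hl ht

lemma soliton_intervalIntegrable {p l : ℝ} (hp : 2 < p) (hl : 0 ≤ l) :
    IntervalIntegrable (fun t => t / √(solitonGap p l t)) volume 0 1 := by
  refine critical_intervalIntegrable.mono_fun' ?_ ?_
  · have := measurable_solitonGap p l
    exact (by fun_prop : Measurable fun t => t / √(solitonGap p l t)).aestronglyMeasurable
  · refine (ae_restrict_mem measurableSet_uIoc).mono fun t ht => ?_
    rw [uIoc_of_le zero_le_one] at ht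
    exact norm_soliton_integrand_le hp hl ht

lemma solitonMass_anti {p l l' : ℝ} (hp : 2 < p) (hl : 0 ≤ l) (hll : l ≤ l') :
    solitonMass p l' ≤ solitonMass p l := by
  refine intervalIntegral.integral_mono_on_of_le_Ioo zero_le_one
    (soliton_intervalIntegrable hp (hl.trans hll)) (soliton_intervalIntegrable hp hl) ?_
  exact fun t ht => soliton_integrand_le hp hl hll ⟨ht.1, ht.2.le⟩

lemma solitonMass_continuousOn {p : ℝ} (hp : 2 < p) : ContinuousOn (solitonMass p) (Ici 0) := by
  intro l hl
  refine intervalIntegral.continuousWithinAt_of_dominated_interval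
    (bound := fun t => t / √((1 - t ^ 4) / 3)) ?_ ?_ critical_intervalIntegrable ?_
  · filter_upwards with l
    have := measurable_solitonGap p l
    exact (by fun_prop : Measurable fun t => t / √(solitonGap p l t)).aestronglyMeasurable
  · filter_upwards [self_mem_nhdsWithin] with l hl
    filter_upwards with t ht
    rw [uIoc_of_le zero_le_one] at ht
    exact norm_soliton_integrand_le hp hl ht
  · have : ∀ᵐ t : ℝ, t ≠ 1 := by simp [ae_iff]
    filter_upwards [this] with t ht1 ht
    rw [uIoc_of_le zero_le_one] at ht
    have := solitonGap_pos hp hl ⟨ht.1.le, lt_of_le_of_ne ht.2 ht1⟩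
    refine ContinuousAt.continuousWithinAt ?_
    refine ContinuousAt.div continuousAt_const ?_ (Real.sqrt_pos.2 this).ne'
    unfold solitonGap
    fun_prop

lemma solitonMass_tendsto {p : ℝ} (hp : 2 < p) :
    Tendsto (solitonMass p) atTop (nhds 0) := by
  have h0 : (0 : ℝ) = ∫ t in (0 : ℝ)..1, (0 : ℝ) := by simp
  rw [h0]
  refine intervalIntegral.tendsto_integral_filter_of_dominated_convergence
    (bound := fun t => t / √((1 - t ^ 4) / 3)) ?_ ?_ critical_intervalIntegrable ?_
  · filter_upwards with l
    have := measurable_solitonGap p l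
    exact (by fun_prop : Measurable fun t => t / √(solitonGap p l t)).aestronglyMeasurable
  · filter_upwards [Ici_mem_atTop 0] with l hl
    filter_upwards with t ht
    rw [uIoc_of_le zero_le_one] at ht
    exact norm_soliton_integrand_le hp hl ht
  · have : ∀ᵐ t : ℝ, t ≠ 1 := by simp [ae_iff]
    filter_upwards [this] with t ht1 ht
    rw [uIoc_of_le zero_le_one] at ht
    have h1 : 0 < 1 - t ^ (p - 2) :=
      sub_pos.2 (Real.rpow_lt_one ht.1.le (lt_of_le_of_ne ht.2 ht1) (by linarith))
    refine Tendsto.const_div_atTop ?_ _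
    refine Real.tendsto_sqrt_atTop.comp ?_
    exact tendsto_atTop_add_const_left _ _ (tendsto_id.atTop_mul_const h1)

lemma exists_solitonMass_eq {p μ : ℝ} (hp : 2 < p) (hμ : 0 < μ) (hμR : μ < π * √3 / 4) :
    ∃ l, 0 < l ∧ solitonMass p l = μ := by
  obtain ⟨L, hL0, hL⟩ := ((eventually_ge_atTop (0 : ℝ)).and
    ((solitonMass_tendsto hp).eventually_lt_const hμ)).exists
  obtain ⟨l, hl, hlμ⟩ := intermediate_value_Icc' hL0
    ((solitonMass_continuousOn hp).mono Icc_subset_Ici_self)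
    ⟨hL.le, by rw [solitonMass_zero]; exact hμR.le⟩
  refine ⟨l, lt_of_le_of_ne hl.1 ?_, hlμ⟩
  rintro rfl
  rw [solitonMass_zero] at hlμ
  exact hμR.ne' hlμ

/-- The potential `h(s) = s⁴/3 + c s^(p-2)`. -/
noncomputable def nlsPot (p c s : ℝ) : ℝ := s ^ 4 / 3 + c * s ^ (p - 2)

/-- The action of the half-soliton of height `M`. -/
noncomputable def solitonAction (p c M : ℝ) : ℝ :=
  ∫ s in (0 : ℝ)..M, s * √(nlsPot p c M - nlsPot p c s)

lemma nlsPot_zero {p c : ℝ} (hp : 2 < p) : nlsPot p c 0 = 0 := by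
  simp [nlsPot, Real.zero_rpow (by linarith : p - 2 ≠ 0)]

lemma nlsPot_continuous {p c : ℝ} (hp : 2 < p) : Continuous (nlsPot p c) := by
  unfold nlsPot
  have : Continuous fun s : ℝ => s ^ (p - 2) := Real.continuous_rpow_const (by linarith)
  fun_prop

lemma nlsPot_strictMonoOn {p c : ℝ} (hp : 2 < p) (hc : 0 < c) :
    StrictMonoOn (nlsPot p c) (Ici 0) := by
  intro a ha b hb hab
  have h1 : a ^ (p - 2) < b ^ (p - 2) := Real.rpow_lt_rpow ha hab (by linarith)
  have h2 : a ^ 4 < b ^ 4 := pow_lt_pow_left₀ hab ha (by norm_num)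
  have := mul_lt_mul_of_pos_left h1 hc
  unfold nlsPot
  linarith

lemma nlsPot_nonneg {p c s : ℝ} (hp : 2 < p) (hc : 0 < c) (hs : 0 ≤ s) : 0 ≤ nlsPot p c s := by
  have := (nlsPot_strictMonoOn hp hc).monotoneOn (self_mem_Ici (a := (0 : ℝ))) hs hs
  rwa [nlsPot_zero hp] at this

lemma exists_nlsPot_eq {p c η : ℝ} (hp : 2 < p) (hc : 0 < c) (hη : 0 < η) :
    ∃ M, 0 < M ∧ nlsPot p c M = η := by
  have h1 : η ≤ nlsPot p c (1 + 3 * η) := by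
    have : 0 ≤ c * (1 + 3 * η) ^ (p - 2) := by positivity
    have h3 : 1 + 3 * η ≤ (1 + 3 * η) ^ 4 := le_self_pow₀ (by linarith) (by norm_num)
    unfold nlsPot
    linarith
  obtain ⟨M, hM, hMη⟩ := intermediate_value_Icc (by positivity : (0 : ℝ) ≤ 1 + 3 * η)
    (nlsPot_continuous (c := c) hp).continuousOn ⟨by rw [nlsPot_zero hp]; exact hη.le, h1⟩
  refine ⟨M, lt_of_le_of_ne hM.1 ?_, hMη⟩
  rintro rfl
  rw [nlsPot_zero hp] at hMη
  exact hη.ne hMη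

lemma nlsPot_sub_scaled {p c M t : ℝ} (hM : 0 < M) (ht : 0 ≤ t) :
    nlsPot p c M - nlsPot p c (M * t) = M ^ 4 * solitonGap p (c * M ^ (p - 6)) t := by
  have h : M ^ (p - 2) = M ^ 4 * M ^ (p - 6) := by
    rw [← Real.rpow_natCast M 4, ← Real.rpow_add hM]
    congr 1
    push_cast
    ring
  unfold nlsPot solitonGap
  rw [Real.mul_rpow hM.le ht, h]
  ring

lemma soliton_integrand_scaled {p c M t : ℝ} (hM : 0 < M) (ht : 0 ≤ t) :
    M * t / √(nlsPot p c M - nlsPot p c (M * t)) =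
      M⁻¹ * (t / √(solitonGap p (c * M ^ (p - 6)) t)) := by
  rw [nlsPot_sub_scaled hM ht, Real.sqrt_mul (by positivity),
    show M ^ 4 = (M ^ 2) ^ 2 by ring, Real.sqrt_sq (by positivity)]
  rcases eq_or_ne (√(solitonGap p (c * M ^ (p - 6)) t)) 0 with h | h
  · simp [h]
  · field_simp

lemma mass_intervalIntegrable {p c M : ℝ} (hp : 2 < p) (hc : 0 < c) (hM : 0 < M) :
    IntervalIntegrable (fun s => s / √(nlsPot p c M - nlsPot p c s)) volume 0 M := by
  have h := (soliton_intervalIntegrable (l := c * M ^ (p - 6)) hp (by positivity)).const_mul M⁻¹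
  have h2 : IntervalIntegrable (fun t => M * t / √(nlsPot p c M - nlsPot p c (M * t)))
      volume 0 1 := by
    refine h.congr fun t ht => ?_
    rw [uIoc_of_le zero_le_one] at ht
    exact (soliton_integrand_scaled hM ht.1.le).symm
  have h3 := h2.comp_mul_left (c := M⁻¹)
  simpa [hM.ne', mul_inv_cancel_left₀] using h3

lemma mass_eq_solitonMass {p c M : ℝ} (hM : 0 < M) :
    ∫ s in (0 : ℝ)..M, s / √(nlsPot p c M - nlsPot p c s) = solitonMass p (c * M ^ (p - 6)) := by
  have h := intervalIntegral.integral_comp_mul_left (a := 0) (b := 1)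
    (fun s => s / √(nlsPot p c M - nlsPot p c s)) hM.ne'
  have h2 : ∫ t in (0 : ℝ)..1, M * t / √(nlsPot p c M - nlsPot p c (M * t)) =
      ∫ t in (0 : ℝ)..1, M⁻¹ * (t / √(solitonGap p (c * M ^ (p - 6)) t)) := by
    refine intervalIntegral.integral_congr fun t ht => ?_
    rw [uIcc_of_le zero_le_one] at ht
    exact soliton_integrand_scaled hM ht.1
  rw [h2, intervalIntegral.integral_const_mul, mul_zero, mul_one, smul_eq_mul] at h
  exact (mul_left_cancel₀ (inv_ne_zero hM.ne') h).symm

lemma lintegral_Ioi_eq_of_sqrt {p c M : ℝ} (hp : 2 < p) (hc : 0 < c) (hM : 0 ≤ M)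
    {f : ℝ → ℝ} (hf : IntervalIntegrable f volume 0 M) (hf0 : ∀ s, 0 < s → 0 ≤ f s)
    (hfz : ∀ s, √(nlsPot p c M - nlsPot p c s) = 0 → f s = 0) :
    ∫⁻ s in Ioi (0 : ℝ), ENNReal.ofReal (f s) = ENNReal.ofReal (∫ s in (0 : ℝ)..M, f s) := by
  rw [intervalIntegral.integral_of_le hM, ofReal_integral_eq_lintegral_ofReal
    ((intervalIntegrable_iff_integrableOn_Ioc_of_le hM).1 hf)
    ((ae_restrict_mem measurableSet_Ioc).mono fun s hs => hf0 s hs.1)]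
  rw [← Ioc_union_Ioi_eq_Ioi hM, lintegral_union measurableSet_Ioi
    (Set.disjoint_left.2 fun s h1 h2 => (not_lt.2 h1.2) h2)]
  nth_rewrite 2 [← add_zero (∫⁻ s in Ioc 0 M, ENNReal.ofReal (f s))]
  congr 1
  refine setLIntegral_eq_zero measurableSet_Ioi fun s hs => ?_
  have h : M < s := hs
  rw [hfz s, ENNReal.ofReal_zero, Pi.zero_apply]
  refine Real.sqrt_eq_zero_of_nonpos (sub_nonpos.2 ?_)
  exact (nlsPot_strictMonoOn hp hc).monotoneOn hM (hM.trans h.le) h.le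

lemma lintegral_mass_eq {p c M : ℝ} (hp : 2 < p) (hc : 0 < c) (hM : 0 < M) :
    ∫⁻ s in Ioi (0 : ℝ), ENNReal.ofReal (s * (√(nlsPot p c M - nlsPot p c s))⁻¹) =
      ENNReal.ofReal (solitonMass p (c * M ^ (p - 6))) := by
  rw [← mass_eq_solitonMass hM]
  exact lintegral_Ioi_eq_of_sqrt hp hc hM.le (mass_intervalIntegrable hp hc hM)
    (fun s hs => by positivity) (fun s hs => by simp [hs])

lemma lintegral_action_eq {p c M : ℝ} (hp : 2 < p) (hc : 0 < c) (hM : 0 ≤ M) :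
    ∫⁻ s in Ioi (0 : ℝ), ENNReal.ofReal (2 * (s * √(nlsPot p c M - nlsPot p c s))) =
      ENNReal.ofReal (2 * solitonAction p c M) := by
  have := nlsPot_continuous (c := c) hp
  rw [solitonAction, ← intervalIntegral.integral_const_mul]
  exact lintegral_Ioi_eq_of_sqrt hp hc hM
    ((by fun_prop : Continuous fun s => 2 * (s * √(nlsPot p c M - nlsPot p c s))).intervalIntegrable
      _ _)
    (fun s hs => by positivity) (fun s hs => by simp [hs])

lemma inv_sqrt_eq_rpow (x : ℝ) : (√x)⁻¹ = x ^ (-(1 / 2) : ℝ) := by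
  rcases le_or_gt 0 x with hx | hx
  · rw [Real.rpow_neg hx, Real.sqrt_eq_rpow]
  · rw [Real.sqrt_eq_zero_of_nonpos hx.le, Real.rpow_def_of_neg hx,
      show (-(1 / 2) * π : ℝ) = -(π / 2) by ring, Real.cos_neg, Real.cos_pi_div_two]
    simp

lemma lintegral_inv_sqrt {a b : ℝ} (x s : ℝ) (hab : a ≤ b) (hs : 0 ≤ s) :
    ∫⁻ η in Ioc a b, ENNReal.ofReal (s * (√(η - x))⁻¹) =
      ENNReal.ofReal (2 * (s * √(b - x)) - 2 * (s * √(a - x))) := by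
  have hi : IntervalIntegrable (fun η => s * (√(η - x))⁻¹) volume a b := by
    simp_rw [inv_sqrt_eq_rpow]
    have := (intervalIntegral.intervalIntegrable_rpow' (a := a - x) (b := b - x)
      (r := -(1 / 2)) (by norm_num)).comp_sub_right x
    simp only [sub_add_cancel] at this
    exact this.const_mul s
  rw [← ofReal_integral_eq_lintegral_ofReal
    ((intervalIntegrable_iff_integrableOn_Ioc_of_le hab).1 hi)
    (Eventually.of_forall fun η => by positivity), ← intervalIntegral.integral_of_le hab,
    intervalIntegral.integral_const_mul]
  simp_rw [inv_sqrt_eq_rpow]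
  rw [intervalIntegral.integral_comp_sub_right (fun y => y ^ (-(1 / 2) : ℝ)),
    integral_rpow (Or.inl (by norm_num)), show (-(1 / 2) + 1 : ℝ) = 1 / 2 by norm_num,
    ← Real.sqrt_eq_rpow, ← Real.sqrt_eq_rpow]
  congr 1
  ring

lemma lintegral_action_add {p c a b : ℝ} (hp : 2 < p) (hab : a ≤ b) :
    ∫⁻ s in Ioi (0 : ℝ), ENNReal.ofReal (2 * (s * √(b - nlsPot p c s))) =
      (∫⁻ s in Ioi (0 : ℝ), ENNReal.ofReal (2 * (s * √(a - nlsPot p c s)))) +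
      ∫⁻ η in Ioc a b, ∫⁻ s in Ioi (0 : ℝ),
        ENNReal.ofReal (s * (√(η - nlsPot p c s))⁻¹) := by
  have hm := (nlsPot_continuous (c := c) hp).measurable
  rw [lintegral_lintegral_swap, ← lintegral_add_left (by fun_prop)]
  · refine setLIntegral_congr_fun measurableSet_Ioi fun s hs => ?_
    have hs : 0 < s := hs
    rw [lintegral_inv_sqrt _ _ hab hs.le, ← ENNReal.ofReal_add (by positivity)]
    · congr 1
      ring
    · rw [sub_nonneg]
      gcongr
  · refine Measurable.aemeasurable ?_
    unfold Function.uncurry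
    fun_prop

/-- The action lies above its tangent line, as a function of the potential level, at the height
`M₀` of the soliton of mass `μ`. -/
lemma solitonAction_tangent {p c M₀ M μ : ℝ} (hp : 2 < p) (hp' : p < 6) (hc : 0 < c)
    (hM₀ : 0 < M₀) (hM : 0 ≤ M) (hμ : solitonMass p (c * M₀ ^ (p - 6)) = μ) (hμ0 : 0 < μ) :
    2 * solitonAction p c M₀ - nlsPot p c M₀ * μ ≤ 2 * solitonAction p c M - nlsPot p c M * μ := by
  have hA : ∀ M, 0 ≤ M → 0 ≤ solitonAction p c M := fun M hM =>
    intervalIntegral.integral_nonneg hM fun s hs => mul_nonneg hs.1 (Real.sqrt_nonneg _)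
  have hmono := nlsPot_strictMonoOn hp hc
  have hpow : ∀ a b, 0 < a → a ≤ b → c * b ^ (p - 6) ≤ c * a ^ (p - 6) := fun a b ha hab =>
    mul_le_mul_of_nonneg_left (Real.rpow_le_rpow_of_nonpos ha hab (by linarith)) hc.le
  rcases le_total M₀ M with h | h
  · have hH := hmono.monotoneOn hM₀.le hM h
    have key := lintegral_action_add (c := c) hp hH
    rw [lintegral_action_eq hp hc hM, lintegral_action_eq hp hc hM₀.le] at key
    have hle : ENNReal.ofReal (μ * (nlsPot p c M - nlsPot p c M₀)) ≤
        ∫⁻ η in Ioc (nlsPot p c M₀) (nlsPot p c M), ∫⁻ s in Ioi (0 : ℝ),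
          ENNReal.ofReal (s * (√(η - nlsPot p c s))⁻¹) := by
      rw [ENNReal.ofReal_mul hμ0.le, ← Real.volume_Ioc, ← setLIntegral_const]
      refine setLIntegral_mono' measurableSet_Ioc fun η hη => ?_
      obtain ⟨N, hN, rfl⟩ := exists_nlsPot_eq hp hc
        ((nlsPot_nonneg hp hc hM₀.le).trans_lt hη.1)
      rw [lintegral_mass_eq hp hc hN, ← hμ]
      have hMN := (hmono.lt_iff_lt hM₀.le hN.le).1 hη.1
      exact ENNReal.ofReal_le_ofReal (solitonMass_anti hp (by positivity) (hpow _ _ hM₀ hMN.le))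
    have h2 := (add_le_add_right hle _).trans_eq key.symm
    rw [← ENNReal.ofReal_add (by linarith [hA M₀ hM₀.le]) (mul_nonneg hμ0.le (sub_nonneg.2 hH)),
      ENNReal.ofReal_le_ofReal_iff (by linarith [hA M hM])] at h2
    linarith
  · have hH := hmono.monotoneOn hM hM₀.le h
    have key := lintegral_action_add (c := c) hp hH
    rw [lintegral_action_eq hp hc hM, lintegral_action_eq hp hc hM₀.le] at key
    have hle : (∫⁻ η in Ioc (nlsPot p c M) (nlsPot p c M₀), ∫⁻ s in Ioi (0 : ℝ),
          ENNReal.ofReal (s * (√(η - nlsPot p c s))⁻¹)) ≤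
        ENNReal.ofReal (μ * (nlsPot p c M₀ - nlsPot p c M)) := by
      rw [ENNReal.ofReal_mul hμ0.le, ← Real.volume_Ioc, ← setLIntegral_const]
      refine setLIntegral_mono' measurableSet_Ioc fun η hη => ?_
      obtain ⟨N, hN, rfl⟩ := exists_nlsPot_eq hp hc
        ((nlsPot_nonneg hp hc hM).trans_lt hη.1)
      rw [lintegral_mass_eq hp hc hN, ← hμ]
      have hMN := (hmono.le_iff_le hN.le hM₀.le).1 hη.2
      exact ENNReal.ofReal_le_ofReal (solitonMass_anti hp (by positivity) (hpow _ _ hN hMN))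
    have h2 := key.le.trans (add_le_add_right hle _)
    rw [← ENNReal.ofReal_add (by linarith [hA M hM]) (mul_nonneg hμ0.le (sub_nonneg.2 hH)),
      ENNReal.ofReal_le_ofReal_iff
        (add_nonneg (by linarith [hA M hM]) (mul_nonneg hμ0.le (sub_nonneg.2 hH)))] at h2
    linarith

/-- The minimal level `2 A - h μ` is negative. -/
lemma exists_solitonAction_neg {p c μ : ℝ} (hp : 2 < p) (hp' : p < 6) (hc : 0 < c) (hμ : 0 < μ) :
    ∃ M, 0 ≤ M ∧ 2 * solitonAction p c M - nlsPot p c M * μ < 0 := by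
  have ht : Tendsto (fun M : ℝ => M ^ (6 - p)) (nhdsWithin 0 (Ioi 0)) (nhds 0) := by
    have := (Real.continuousAt_rpow_const (0 : ℝ) (6 - p) (Or.inr (by linarith))).tendsto
    rw [Real.zero_rpow (by linarith)] at this
    exact this.mono_left nhdsWithin_le_nhds
  obtain ⟨M, hM, hM0⟩ := ((ht.eventually_lt_const (by positivity : 0 < c * μ ^ 2)).and
    self_mem_nhdsWithin).exists
  have hM0 : 0 < M := hM0
  refine ⟨M, hM0.le, ?_⟩
  have hH : c * M ^ (p - 2) ≤ nlsPot p c M := by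
    unfold nlsPot
    have : 0 ≤ M ^ 4 / 3 := by positivity
    linarith
  have hHpos : 0 < nlsPot p c M := lt_of_lt_of_le (by positivity) hH
  have hcont := nlsPot_continuous (c := c) hp
  have hA : solitonAction p c M ≤ ∫ s in (0 : ℝ)..M, s * √(nlsPot p c M) := by
    refine intervalIntegral.integral_mono_on hM0.le
      ((by fun_prop : Continuous fun s => s * √(nlsPot p c M - nlsPot p c s)).intervalIntegrable
        _ _)
      ((by fun_prop : Continuous fun s => s * √(nlsPot p c M)).intervalIntegrable _ _) fun s hs => ?_
    have := nlsPot_nonneg hp hc hs.1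
    exact mul_le_mul_of_nonneg_left (Real.sqrt_le_sqrt (by linarith)) hs.1
  rw [intervalIntegral.integral_mul_const, integral_id] at hA
  have hM4 : M ^ (6 - p) * M ^ (p - 2) = M ^ 4 := by
    rw [← Real.rpow_add hM0, ← Real.rpow_natCast M 4]
    congr 1
    push_cast
    ring
  have h1 : M ^ 4 < μ ^ 2 * nlsPot p c M := by
    rw [← hM4]
    have := mul_lt_mul_of_pos_right hM (by positivity : 0 < M ^ (p - 2))
    nlinarith [mul_le_mul_of_nonneg_left hH (sq_nonneg μ)]
  have hs := Real.sq_sqrt hHpos.le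
  have hspos := Real.sqrt_pos.2 hHpos
  have h2 : M ^ 2 < μ * √(nlsPot p c M) := by
    refine lt_of_pow_lt_pow_left₀ 2 (by positivity) ?_
    rw [mul_pow, hs]
    linarith [show (M ^ 2) ^ 2 = M ^ 4 by ring]
  have := mul_lt_mul_of_pos_right h2 hspos
  nlinarith

lemma nlsPot_sub_pos {p c M s : ℝ} (hp : 2 < p) (hc : 0 < c) (hs : 0 ≤ s) (hsM : s < M) :
    0 < nlsPot p c M - nlsPot p c s :=
  sub_pos.2 (nlsPot_strictMonoOn hp hc hs (hs.trans hsM.le) hsM)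

/-- The inverse logarithmic speed of the soliton, as a function of logarithmic height. -/
noncomputable def solitonInvSpeed (p c M y : ℝ) : ℝ :=
  (√(nlsPot p c M - nlsPot p c (M * exp (-|y|))))⁻¹

lemma measurable_solitonInvSpeed {p c M : ℝ} (hp : 2 < p) :
    Measurable (solitonInvSpeed p c M) := by
  have := (nlsPot_continuous (c := c) hp).measurable
  unfold solitonInvSpeed
  fun_prop

lemma mul_exp_neg_abs_lt {M y : ℝ} (hM : 0 < M) (hy : y ≠ 0) : M * exp (-|y|) < M :=
  mul_lt_of_lt_one_right hM (by simpa using hy)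

lemma solitonInvSpeed_pos_arg {p c M y : ℝ} (hp : 2 < p) (hc : 0 < c) (hM : 0 < M) (hy : y ≠ 0) :
    0 < nlsPot p c M - nlsPot p c (M * exp (-|y|)) :=
  nlsPot_sub_pos hp hc (by positivity) (mul_exp_neg_abs_lt hM hy)

lemma solitonInvSpeed_le {p c M L y : ℝ} (hp : 2 < p) (hc : 0 < c) (hM : 0 < M)
    (hy : 0 < y) (hyL : y ≤ L) :
    solitonInvSpeed p c M y ≤ (√(4 * M ^ 4 / (3 * (1 + 4 * L))))⁻¹ * y ^ (-(1 / 2) : ℝ) := by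
  have hL : 0 < L := hy.trans_le hyL
  rw [← inv_sqrt_eq_rpow, ← mul_inv, ← Real.sqrt_mul (by positivity)]
  unfold solitonInvSpeed
  refine inv_anti₀ (Real.sqrt_pos.2 (by positivity)) (Real.sqrt_le_sqrt ?_)
  rw [abs_of_pos hy, nlsPot_sub_scaled hM (by positivity)]
  have h1 := solitonGap_ge (p := p) (l := c * M ^ (p - 6)) (t := exp (-y)) hp (by positivity)
    ⟨by positivity, by simpa using hy.le⟩
  have h2 : exp (-y) ^ 4 ≤ 1 / (1 + 4 * y) := by
    rw [← Real.exp_nat_mul, le_div_iff₀ (by positivity), mul_comm]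
    have := Real.add_one_le_exp (4 * y)
    calc (1 + 4 * y) * exp (((4 : ℕ) : ℝ) * -y) ≤ exp (4 * y) * exp (((4 : ℕ) : ℝ) * -y) := by
          gcongr
          linarith
      _ = 1 := by
          rw [← Real.exp_add]
          simp
  have h3 : 4 * y / (3 * (1 + 4 * L)) ≤ (1 - exp (-y) ^ 4) / 3 := by
    have h4 : 4 * y / (3 * (1 + 4 * L)) ≤ 4 * y / (3 * (1 + 4 * y)) := by gcongr
    have h5 : 4 * y / (3 * (1 + 4 * y)) = (1 - 1 / (1 + 4 * y)) / 3 := by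
      field_simp
      ring
    linarith
  calc 4 * M ^ 4 / (3 * (1 + 4 * L)) * y = M ^ 4 * (4 * y / (3 * (1 + 4 * L))) := by ring
    _ ≤ _ := mul_le_mul_of_nonneg_left (h3.trans h1) (by positivity)

lemma solitonInvSpeed_intervalIntegrable {p c M : ℝ} (hp : 2 < p) (hc : 0 < c) (hM : 0 < M)
    (a b : ℝ) : IntervalIntegrable (solitonInvSpeed p c M) volume a b := by
  refine intervalIntegrable_of_even (fun x => by simp [solitonInvSpeed]) (fun L hL => ?_)
  refine ((intervalIntegral.intervalIntegrable_rpow' (a := 0) (b := L)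
    (r := -(1 / 2)) (by norm_num)).const_mul
    (√(4 * M ^ 4 / (3 * (1 + 4 * L))))⁻¹).mono_fun'
    (measurable_solitonInvSpeed hp).aestronglyMeasurable ?_
  refine (ae_restrict_mem measurableSet_uIoc).mono fun y hy => ?_
  rw [uIoc_of_le hL.le] at hy
  simp only
  rw [Real.norm_of_nonneg (by unfold solitonInvSpeed; positivity)]
  exact solitonInvSpeed_le hp hc hM hy.1 hy.2

/-- The half-soliton of height `M`, obtained by inverting its travel time. -/
lemma exists_soliton {p c M : ℝ} (hp : 2 < p) (hc : 0 < c) (hM : 0 < M) :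
    ∃ u : ℝ → ℝ, Continuous u ∧ u 0 = M ∧ Tendsto u atTop (nhds 0) ∧
      ∀ x, 0 < x → u x ∈ Ioo 0 M ∧
        HasDerivAt u (-(u x * √(nlsPot p c M - nlsPot p c (u x)))) x := by
  set k := solitonInvSpeed p c M with hk
  have hint := solitonInvSpeed_intervalIntegrable hp hc hM
  set S : ℝ → ℝ := fun y => ∫ τ in (0 : ℝ)..y, k τ with hS
  have hScont : Continuous S := intervalIntegral.continuous_primitive hint 0
  have hH : 0 < √(nlsPot p c M) := by
    have := nlsPot_sub_pos hp hc le_rfl hM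
    rw [nlsPot_zero hp, sub_zero] at this
    exact Real.sqrt_pos.2 this
  have hgrow : ∀ a b, a ≤ b → (b - a) * (√(nlsPot p c M))⁻¹ ≤ S b - S a := by
    intro a b hab
    have hne : ∀ᵐ t : ℝ, t ≠ 0 := by simp [ae_iff]
    have h : ∫ _ in a..b, (√(nlsPot p c M))⁻¹ ≤ ∫ τ in a..b, k τ := by
      refine intervalIntegral.integral_mono_ae hab (by simp) (hint a b) ?_
      filter_upwards [hne] with y hy
      refine inv_anti₀ (Real.sqrt_pos.2 (solitonInvSpeed_pos_arg hp hc hM hy))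
        (Real.sqrt_le_sqrt ?_)
      have := nlsPot_nonneg (s := M * exp (-|y|)) hp hc (by positivity)
      linarith
    rwa [intervalIntegral.integral_const, smul_eq_mul,
      ← intervalIntegral.integral_interval_sub_left (hint 0 b) (hint 0 a)] at h
  have hSmono : StrictMono S := fun a b hab => by
    have := hgrow a b hab.le
    have : 0 < (b - a) * (√(nlsPot p c M))⁻¹ := mul_pos (sub_pos.2 hab) (inv_pos.2 hH)
    linarith
  have hS0 : S 0 = 0 := by simp [hS]
  have hSsurj : Function.Surjective S := by
    refine hScont.surjective ?_ ?_
    · refine tendsto_atTop_mono' _ ?_ (tendsto_id.atTop_mul_const (inv_pos.2 hH))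
      filter_upwards [Ici_mem_atTop 0] with y hy
      simpa [hS0] using hgrow 0 y hy
    · refine tendsto_atBot_mono' _ ?_ (tendsto_id.atBot_mul_const (inv_pos.2 hH))
      filter_upwards [Iic_mem_atBot 0] with y hy
      have := hgrow y 0 hy
      rw [hS0] at this
      simp only [id]
      linarith
  set e := StrictMono.orderIsoOfSurjective S hSmono hSsurj with he
  have heS : ∀ x, S (e.symm x) = x := fun x => e.apply_symm_apply x
  have hY0 : e.symm 0 = 0 := by
    rw [OrderIso.symm_apply_eq]
    exact hS0.symm
  have hYc : Continuous e.symm := e.symm.continuous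
  have hYpos : ∀ x, 0 < x → 0 < e.symm x := fun x hx => by
    rw [← hY0]
    exact e.symm.strictMono hx
  refine ⟨fun x => M * exp (-e.symm x), by fun_prop, by simp [hY0], ?_, fun x hx => ?_⟩
  · have h := (Real.tendsto_exp_neg_atTop_nhds_zero.comp e.symm.tendsto_atTop).const_mul M
    simpa using h
  · have hy := hYpos x hx
    have hlt := mul_exp_neg_abs_lt hM hy.ne'
    have hpos := solitonInvSpeed_pos_arg hp hc hM hy.ne'
    rw [abs_of_pos hy] at hlt hpos
    refine ⟨⟨by positivity, hlt⟩, ?_⟩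
    have hkc : ContinuousAt k (e.symm x) := by
      refine ContinuousAt.inv₀ ?_ ?_
      · have := nlsPot_continuous (c := c) hp
        fun_prop
      · rw [abs_of_pos hy]
        exact (Real.sqrt_pos.2 hpos).ne'
    have hkx : k (e.symm x) = (√(nlsPot p c M - nlsPot p c (M * exp (-e.symm x))))⁻¹ := by
      rw [hk, solitonInvSpeed, abs_of_pos hy]
    have hSd : HasDerivAt S (k (e.symm x)) (e.symm x) :=
      intervalIntegral.integral_hasDerivAt_right (hint 0 _)
        (measurable_solitonInvSpeed hp).stronglyMeasurable.stronglyMeasurableAtFilter hkc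
    have hYd := HasDerivAt.of_local_left_inverse hYc.continuousAt hSd
      (by rw [hkx]; exact inv_ne_zero (Real.sqrt_pos.2 hpos).ne') (Eventually.of_forall heS)
    refine ((hYd.neg.exp).const_mul M).congr_deriv ?_
    rw [hkx, inv_inv]
    simp only [Pi.neg_apply]
    ring

lemma sq_mul_nlsPot_abs {p c : ℝ} (hp : 2 < p) (s : ℝ) :
    s ^ 2 * nlsPot p c |s| = |s| ^ 6 / 3 + c * |s| ^ p := by
  rcases eq_or_ne s 0 with rfl | hs
  · simp [Real.zero_rpow (by linarith : p ≠ 0)]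
  · have h : |s| ^ p = |s| ^ 2 * |s| ^ (p - 2) := by
      rw [← Real.rpow_natCast |s| 2, ← Real.rpow_add (abs_pos.2 hs)]
      congr 1
      push_cast
      ring
    rw [h, nlsPot, ← sq_abs s]
    ring

/-- The speed at height `s` of the soliton with frequency `H`. -/
noncomputable def solitonSpeed (p c H s : ℝ) : ℝ := |s| * √(H - nlsPot p c |s|)

lemma solitonSpeed_continuous {p c : ℝ} (H : ℝ) (hp : 2 < p) :
    Continuous (solitonSpeed p c H) := by
  have := nlsPot_continuous (c := c) hp
  unfold solitonSpeed
  fun_prop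

lemma solitonSpeed_nonneg (p c H s : ℝ) : 0 ≤ solitonSpeed p c H s := by
  unfold solitonSpeed
  positivity

lemma solitonSpeed_primitive_hasDerivAt {p c : ℝ} (H : ℝ) (hp : 2 < p) (s : ℝ) :
    HasDerivAt (fun s => ∫ r in (0 : ℝ)..s, solitonSpeed p c H r) (solitonSpeed p c H s) s :=
  intervalIntegral.integral_hasDerivAt_right
    ((solitonSpeed_continuous H hp).intervalIntegrable _ _)
    (solitonSpeed_continuous H hp).stronglyMeasurable.stronglyMeasurableAtFilter
    (solitonSpeed_continuous H hp).continuousAt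

lemma integral_solitonSpeed_eq {p c M : ℝ} (hM : 0 ≤ M) :
    ∫ r in (0 : ℝ)..M, solitonSpeed p c (nlsPot p c M) r = solitonAction p c M := by
  refine intervalIntegral.integral_congr fun s hs => ?_
  rw [uIcc_of_le hM] at hs
  simp only [solitonSpeed]
  rw [abs_of_nonneg hs.1]

lemma abs_integral_solitonSpeed {p c H : ℝ} (s : ℝ) :
    |∫ r in (0 : ℝ)..|s|, solitonSpeed p c H r| = |∫ r in (0 : ℝ)..s, solitonSpeed p c H r| := by
  rcases abs_choice s with h | h
  · rw [h]
  · have h2 := intervalIntegral.integral_comp_neg (a := 0) (b := s) (solitonSpeed p c H)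
    simp only [solitonSpeed, abs_neg, neg_zero] at h2
    rw [h]
    simp only [solitonSpeed]
    rw [h2, intervalIntegral.integral_symm, abs_neg]

lemma H1halfline.exists_bound {u u' : ℝ → ℝ} (h : H1halfline u u') :
    ∃ K, ∀ x, 0 ≤ x → |u x| ≤ K := by
  obtain ⟨hc, hd, hi, hi'⟩ := h
  have hφ : IntegrableOn (fun x => u x ^ 2 + u' x ^ 2) (Ioi 0) := hi.add hi'
  refine ⟨√(u 0 ^ 2 + ∫ x in Ioi (0 : ℝ), (u x ^ 2 + u' x ^ 2)), fun x hx => ?_⟩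
  refine Real.abs_le_sqrt ?_
  have h1 := intervalIntegral.sub_le_integral_of_hasDeriv_right_of_le hx
    (g := fun x => u x ^ 2) (g' := fun x => 2 * u x * u' x) (φ := fun x => u x ^ 2 + u' x ^ 2)
    ((hc.mono Icc_subset_Ici_self).pow 2)
    (fun y hy => by simpa using! ((hd y hy.1).pow 2).hasDerivWithinAt)
    ((integrableOn_Icc_iff_integrableOn_Ioc).2 (hφ.mono_set Ioc_subset_Ioi_self))
    (fun y _ => by nlinarith [sq_nonneg (u y - u' y)])
  have h2 : ∫ y in (0 : ℝ)..x, (u y ^ 2 + u' y ^ 2) ≤ ∫ y in Ioi (0 : ℝ), (u y ^ 2 + u' y ^ 2) := by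
    rw [intervalIntegral.integral_of_le hx]
    exact setIntegral_mono_set hφ (Eventually.of_forall fun y => by positivity)
      Ioc_subset_Ioi_self.eventuallyLE
  linarith

lemma H1halfline.integrableOn_rpow {u u' : ℝ → ℝ} (h : H1halfline u u') {r : ℝ} (hr : 2 ≤ r) :
    IntegrableOn (fun x => |u x| ^ r) (Ioi 0) := by
  obtain ⟨K, hK⟩ := h.exists_bound
  refine Integrable.mono' (h.2.2.1.const_mul (K ^ (r - 2))) ?_ ?_
  · have hm : AEMeasurable u (volume.restrict (Ioi 0)) :=
      (h.1.mono Ioi_subset_Ici_self).aemeasurable measurableSet_Ioi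
    exact (by fun_prop : AEMeasurable (fun x => |u x| ^ r) _).aestronglyMeasurable
  · refine (ae_restrict_mem measurableSet_Ioi).mono fun x hx => ?_
    rw [Real.norm_of_nonneg (by positivity)]
    rcases eq_or_ne (u x) 0 with h0 | h0
    · simp [h0, Real.zero_rpow (by linarith : r ≠ 0)]
    · have hs : |u x| ^ r = |u x| ^ (r - 2) * u x ^ 2 := by
        rw [← sq_abs, ← Real.rpow_natCast |u x| 2, ← Real.rpow_add (abs_pos.2 h0)]
        congr 1
        push_cast
        ring
      rw [hs]
      have := Real.rpow_le_rpow (abs_nonneg _) (hK x (le_of_lt hx)) (by linarith : 0 ≤ r - 2)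
      gcongr

lemma H1halfline.integrableOn_pow_six {u u' : ℝ → ℝ} (h : H1halfline u u') :
    IntegrableOn (fun x => |u x| ^ 6) (Ioi 0) := by
  have := h.integrableOn_rpow (r := ((6 : ℕ) : ℝ)) (by norm_num)
  simpa only [Real.rpow_natCast] using this

lemma exists_abs_lt_of_integrableOn_sq {u : ℝ → ℝ} (h : IntegrableOn (fun x => u x ^ 2) (Ioi 0))
    {x ε : ℝ} (hx : 0 ≤ x) (hε : 0 < ε) : ∃ y, x ≤ y ∧ |u y| < ε := by
  by_contra! hcon
  have h1 : IntegrableOn (fun _ : ℝ => ε ^ 2) (Ioi x) := by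
    refine Integrable.mono' (h.mono_set (Ioi_subset_Ioi hx)) (by fun_prop) ?_
    refine (ae_restrict_mem measurableSet_Ioi).mono fun y hy => ?_
    rw [Real.norm_of_nonneg (by positivity), ← sq_abs (u y)]
    exact pow_le_pow_left₀ hε.le (hcon y (le_of_lt hy)) 2
  rw [integrableOn_const_iff] at h1
  simp [hε.ne'] at h1

lemma integral_solitonSpeed_le_of_le {p c H x y I : ℝ} {u u' φ : ℝ → ℝ} (hp : 2 < p)
    (hu : H1halfline u u') (hφ : IntegrableOn φ (Ioi 0))
    (hφu : ∀ x, 0 < x → solitonSpeed p c H (u x) * |u' x| ≤ φ x)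
    (hI : ∫ x in Ioi (0 : ℝ), φ x ≤ I) (hx : 0 ≤ x) (hxy : x ≤ y) :
    |∫ r in (0 : ℝ)..u x, solitonSpeed p c H r| ≤
      |∫ r in (0 : ℝ)..u y, solitonSpeed p c H r| + I := by
  have hφ0 : ∀ x, 0 < x → 0 ≤ φ x := fun x hx =>
    (mul_nonneg (solitonSpeed_nonneg _ _ _ _) (abs_nonneg _)).trans (hφu x hx)
  set Q : ℝ → ℝ := fun s => ∫ r in (0 : ℝ)..s, solitonSpeed p c H r with hQ
  have hQd := solitonSpeed_primitive_hasDerivAt (c := c) H hp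
  have hQc : Continuous Q := continuous_iff_continuousAt.2 fun s => (hQd s).continuousAt
  have hQu : ContinuousOn (fun x => Q (u x)) (Icc x y) :=
    hQc.comp_continuousOn (hu.1.mono ((Icc_subset_Ici_self).trans (Ici_subset_Ici.2 hx)))
  have hQud : ∀ z ∈ Ioo x y,
      HasDerivAt (fun x => Q (u x)) (solitonSpeed p c H (u z) * u' z) z := fun z hz =>
    (hQd (u z)).comp z (hu.2.1 z (hx.trans_lt hz.1))
  have hφi : IntegrableOn φ (Icc x y) :=
    (integrableOn_Icc_iff_integrableOn_Ioc).2 (hφ.mono_set fun z hz => hx.trans_lt hz.1)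
  have h1 := intervalIntegral.sub_le_integral_of_hasDeriv_right_of_le hxy hQu
    (fun z hz => (hQud z hz).hasDerivWithinAt) hφi fun z hz =>
      (mul_le_mul_of_nonneg_left (le_abs_self _) (solitonSpeed_nonneg _ _ _ _)).trans
        (hφu z (hx.trans_lt hz.1))
  have h2 := intervalIntegral.sub_le_integral_of_hasDeriv_right_of_le hxy hQu.neg
    (fun z hz => (hQud z hz).neg.hasDerivWithinAt) hφi fun z hz => by
      rw [← mul_neg]
      exact (mul_le_mul_of_nonneg_left (neg_le_abs _) (solitonSpeed_nonneg _ _ _ _)).trans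
        (hφu z (hx.trans_lt hz.1))
  have h3 : ∫ z in x..y, φ z ≤ ∫ z in Ioi (0 : ℝ), φ z := by
    rw [intervalIntegral.integral_of_le hxy]
    exact setIntegral_mono_set hφ ((ae_restrict_mem measurableSet_Ioi).mono hφ0)
      (LE.le.eventuallyLE fun z hz => hx.trans_lt hz.1)
  have h4 : |Q (u x) - Q (u y)| ≤ I := by
    simp only [Pi.neg_apply] at h2
    rw [abs_le]
    constructor <;> linarith
  have := abs_sub_abs_le_abs_sub (Q (u x)) (Q (u y))
  linarith

/-- Lower bound of the energy by the action of the soliton whose height is `sup |v|`. -/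
lemma H1halfline.exists_le_energy {p α μ : ℝ} {v v' : ℝ → ℝ} (hp : 2 < p) (hα : 0 < α)
    (hv : H1halfline v v') (hμ : ∫ x in Ioi (0 : ℝ), v x ^ 2 = μ) :
    ∃ M, 0 ≤ M ∧ 2 * solitonAction p (2 * α / p) M - nlsPot p (2 * α / p) M * μ ≤
      2 * Ehalfline p α v v' := by
  set c := 2 * α / p with hc
  have hc0 : 0 < c := by positivity
  obtain ⟨K, hK⟩ := hv.exists_bound
  set A : Set ℝ := (fun x => |v x|) '' Ici 0 with hA
  have hAne : A.Nonempty := ⟨|v 0|, 0, self_mem_Ici, rfl⟩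
  have hAb : BddAbove A := ⟨K, by rintro _ ⟨x, hx, rfl⟩; exact hK x hx⟩
  set M := sSup A with hM
  have hvM : ∀ x, 0 ≤ x → |v x| ≤ M := fun x hx => le_csSup hAb ⟨x, hx, rfl⟩
  have hM0 : 0 ≤ M := (abs_nonneg _).trans (hvM 0 le_rfl)
  set H := nlsPot p c M with hH
  set ψ : ℝ → ℝ := fun x => 1 / 2 * (v' x) ^ 2 - 1 / 6 * |v x| ^ 6 - α / p * |v x| ^ p with hψ
  have hψi : IntegrableOn ψ (Ioi 0) :=
    ((hv.2.2.2.const_mul _).sub (hv.integrableOn_pow_six.const_mul _)).sub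
      ((hv.integrableOn_rpow hp.le).const_mul _)
  have hmi : IntegrableOn (fun x => H / 2 * v x ^ 2) (Ioi 0) := hv.2.2.1.const_mul _
  have hI : ∫ x in Ioi (0 : ℝ), (ψ x + H / 2 * v x ^ 2) = Ehalfline p α v v' + H / 2 * μ := by
    rw [integral_add hψi hmi, integral_const_mul, hμ]
    rfl
  have hφu : ∀ x, 0 < x → solitonSpeed p c H (v x) * |v' x| ≤ ψ x + H / 2 * v x ^ 2 := by
    intro x hx
    have hle : nlsPot p c |v x| ≤ H :=
      (nlsPot_strictMonoOn hp hc0).monotoneOn (mem_Ici.2 (abs_nonneg _)) hM0 (hvM x hx.le)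
    have hsq : solitonSpeed p c H (v x) ^ 2 = v x ^ 2 * H - v x ^ 2 * nlsPot p c |v x| := by
      rw [solitonSpeed, mul_pow, Real.sq_sqrt (sub_nonneg.2 hle), sq_abs]
      ring
    rw [sq_mul_nlsPot_abs hp] at hsq
    have h2 := sq_nonneg (solitonSpeed p c H (v x) - |v' x|)
    have h3 := sq_abs (v' x)
    have h4 : c * |v x| ^ p = 2 * (α / p * |v x| ^ p) := by
      rw [hc]
      ring
    simp only [hψ]
    nlinarith
  set I := Ehalfline p α v v' + H / 2 * μ with hIdef
  have hstep := fun x y => integral_solitonSpeed_le_of_le (x := x) (y := y) hp hv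
    (hψi.add hmi) hφu hI.le
  have hQc : Continuous fun s => ∫ r in (0 : ℝ)..s, solitonSpeed p c H r :=
    continuous_iff_continuousAt.2 fun s => (solitonSpeed_primitive_hasDerivAt H hp s).continuousAt
  have hbound : ∀ x, 0 ≤ x → |∫ r in (0 : ℝ)..v x, solitonSpeed p c H r| ≤ I := by
    intro x hx
    have hcl : IsClosed {s : ℝ | |∫ r in (0 : ℝ)..v x, solitonSpeed p c H r| ≤
        |∫ r in (0 : ℝ)..s, solitonSpeed p c H r| + I} :=
      isClosed_le (by fun_prop) (by fun_prop)
    have h0 : (0 : ℝ) ∈ closure {s : ℝ | |∫ r in (0 : ℝ)..v x, solitonSpeed p c H r| ≤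
        |∫ r in (0 : ℝ)..s, solitonSpeed p c H r| + I} := by
      refine Metric.mem_closure_iff.2 fun ε hε => ?_
      obtain ⟨y, hxy, hy⟩ := exists_abs_lt_of_integrableOn_sq hv.2.2.1 hx hε
      exact ⟨v y, hstep x y hx hxy, by simpa [Real.dist_eq] using hy⟩
    rw [hcl.closure_eq] at h0
    simpa using h0
  have hQM : |∫ r in (0 : ℝ)..M, solitonSpeed p c H r| ≤ I := by
    have hcl : IsClosed {s : ℝ | |∫ r in (0 : ℝ)..s, solitonSpeed p c H r| ≤ I} :=
      isClosed_le (by fun_prop) (by fun_prop)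
    refine hcl.closure_subset_iff.2 ?_ (csSup_mem_closure hAne hAb)
    rintro _ ⟨x, hx, rfl⟩
    simp only [mem_ofPred_eq]
    rw [abs_integral_solitonSpeed]
    exact hbound x hx
  refine ⟨M, hM0, ?_⟩
  rw [integral_solitonSpeed_eq hM0] at hQM
  have := (le_abs_self _).trans hQM
  linarith

/-- The half-soliton of height `M` lies in `H¹(ℝ⁺)`; its mass and its energy are explicit. -/
lemma exists_soliton_H1halfline {p α M : ℝ} (hp : 2 < p) (hα : 0 < α) (hM : 0 < M) :
    ∃ u u' : ℝ → ℝ, H1halfline u u' ∧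
      ∫ x in Ioi (0 : ℝ), u x ^ 2 = solitonMass p (2 * α / p * M ^ (p - 6)) ∧
      2 * Ehalfline p α u u' = 2 * solitonAction p (2 * α / p) M - nlsPot p (2 * α / p) M *
        solitonMass p (2 * α / p * M ^ (p - 6)) := by
  set c := 2 * α / p with hc
  have hc0 : 0 < c := by positivity
  obtain ⟨u, huc, hu0, hulim, hu⟩ := exists_soliton hp hc0 hM
  set H := nlsPot p c M with hH
  have hucc : ∀ x, 0 ≤ x → u x ∈ Icc 0 M := by
    intro x hx
    rcases hx.eq_or_lt with rfl | hx
    · rw [hu0]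
      exact ⟨hM.le, le_rfl⟩
    · exact Ioo_subset_Icc_self (hu x hx).1
  set u' : ℝ → ℝ := fun x => -(u x * √(H - nlsPot p c (u x))) with hu'
  set f : ℝ → ℝ := fun s => s / √(H - nlsPot p c s) with hf
  have hfi : IntervalIntegrable f volume 0 M := mass_intervalIntegrable hp hc0 hM
  have hfc : ContinuousOn (fun s => ∫ r in (0 : ℝ)..s, f r) (Icc 0 M) := by
    have := intervalIntegral.continuousOn_primitive_interval (μ := volume) (f := f) (a := 0)
      (b := M) (by
        rw [uIcc_of_le hM.le]
        exact (intervalIntegrable_iff_integrableOn_Icc_of_le hM.le).1 hfi)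
    rwa [uIcc_of_le hM.le] at this
  have hRcont : ContinuousWithinAt (fun x => ∫ r in (0 : ℝ)..u x, f r) (Ici 0) 0 :=
    (hfc.comp huc.continuousOn hucc) 0 self_mem_Ici
  have hRd : ∀ x ∈ Ioi (0 : ℝ),
      HasDerivAt (fun x => ∫ r in (0 : ℝ)..u x, f r) (-(u x ^ 2)) x := by
    intro x hx
    obtain ⟨hux, hud⟩ := hu x hx
    have hpos := nlsPot_sub_pos hp hc0 hux.1.le hux.2
    have hcont := nlsPot_continuous (c := c) hp
    have hfm : Measurable f := by
      have := hcont.measurable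
      fun_prop
    have hfd : HasDerivAt (fun s => ∫ r in (0 : ℝ)..s, f r) (f (u x)) (u x) := by
      refine intervalIntegral.integral_hasDerivAt_right (hfi.mono_set ?_)
        hfm.stronglyMeasurable.stronglyMeasurableAtFilter ?_
      · rw [uIcc_of_le hux.1.le, uIcc_of_le hM.le]
        exact Icc_subset_Icc_right hux.2.le
      · exact ContinuousAt.div continuousAt_id (by fun_prop) (Real.sqrt_pos.2 hpos).ne'
    refine (hfd.comp x hud).congr_deriv ?_
    have := (Real.sqrt_pos.2 hpos).ne'
    simp only [hf, hH]
    field_simp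
  have hRlim : Tendsto (fun x => ∫ r in (0 : ℝ)..u x, f r) atTop (nhds 0) := by
    have h1 : Tendsto u atTop (nhdsWithin 0 (Icc 0 M)) :=
      tendsto_nhdsWithin_iff.2 ⟨hulim, (eventually_ge_atTop 0).mono hucc⟩
    simpa [Function.comp_def] using (hfc 0 ⟨le_rfl, hM.le⟩).tendsto.comp h1
  have hRneg : ∀ x ∈ Ioi (0 : ℝ), -(u x ^ 2) ≤ 0 := fun x _ => by
    linarith [sq_nonneg (u x)]
  have hmi : IntegrableOn (fun x => u x ^ 2) (Ioi 0) := by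
    simpa using (integrableOn_Ioi_deriv_of_nonpos hRcont hRd hRneg hRlim).neg
  have hmass : ∫ x in Ioi (0 : ℝ), u x ^ 2 = solitonMass p (c * M ^ (p - 6)) := by
    have := integral_Ioi_of_hasDerivAt_of_nonpos hRcont hRd hRneg hRlim
    rw [integral_neg, hu0, hf, mass_eq_solitonMass hM] at this
    linarith
  have hspeed : ∀ x, 0 ≤ x → solitonSpeed p c H (u x) = -u' x := fun x hx => by
    simp only [solitonSpeed, hu', abs_of_nonneg (hucc x hx).1, neg_neg]
  have hQd := solitonSpeed_primitive_hasDerivAt (c := c) H hp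
  have hQc : Continuous fun s => ∫ r in (0 : ℝ)..s, solitonSpeed p c H r :=
    continuous_iff_continuousAt.2 fun s => (hQd s).continuousAt
  have hKcont : ContinuousWithinAt (fun x => ∫ r in (0 : ℝ)..u x, solitonSpeed p c H r)
      (Ici 0) 0 := (hQc.comp huc).continuousWithinAt
  have hKd : ∀ x ∈ Ioi (0 : ℝ), HasDerivAt (fun x => ∫ r in (0 : ℝ)..u x, solitonSpeed p c H r)
      (-(u' x ^ 2)) x := by
    intro x hx
    refine ((hQd (u x)).comp x (hu x hx).2).congr_deriv ?_
    rw [hspeed x (le_of_lt hx)]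
    ring
  have hKneg : ∀ x ∈ Ioi (0 : ℝ), -(u' x ^ 2) ≤ 0 := fun x _ => by
    linarith [sq_nonneg (u' x)]
  have hKlim : Tendsto (fun x => ∫ r in (0 : ℝ)..u x, solitonSpeed p c H r) atTop (nhds 0) := by
    simpa [Function.comp_def] using (hQc.tendsto 0).comp hulim
  have hki : IntegrableOn (fun x => u' x ^ 2) (Ioi 0) := by
    simpa using (integrableOn_Ioi_deriv_of_nonpos hKcont hKd hKneg hKlim).neg
  have hkin : ∫ x in Ioi (0 : ℝ), u' x ^ 2 = solitonAction p c M := by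
    have := integral_Ioi_of_hasDerivAt_of_nonpos hKcont hKd hKneg hKlim
    rw [integral_neg, hu0, integral_solitonSpeed_eq hM.le] at this
    linarith
  refine ⟨u, u', ⟨huc.continuousOn, fun x hx => (hu x hx).2, hmi, hki⟩, hmass, ?_⟩
  have hE : Ehalfline p α u u' = ∫ x in Ioi (0 : ℝ), (u' x ^ 2 - H / 2 * u x ^ 2) := by
    refine setIntegral_congr_fun measurableSet_Ioi fun x hx => ?_
    have hux := hucc x (le_of_lt hx)
    have hle : nlsPot p c (u x) ≤ H :=
      (nlsPot_strictMonoOn hp hc0).monotoneOn hux.1 hM.le hux.2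
    have hsq : u' x ^ 2 = u x ^ 2 * H - u x ^ 2 * nlsPot p c |u x| := by
      rw [hu', abs_of_nonneg hux.1]
      simp only
      rw [neg_sq, mul_pow, Real.sq_sqrt (sub_nonneg.2 hle)]
      ring
    rw [sq_mul_nlsPot_abs hp] at hsq
    have h4 : c * |u x| ^ p = 2 * (α / p * |u x| ^ p) := by
      rw [hc]
      ring
    linarith
  rw [hE, integral_sub hki (hmi.const_mul _), integral_const_mul, hkin, hmass]
  ring

/-- Focusing case on the half-line: for `p ∈ (2,6)`, `α > 0` and `μ ∈ (0, μ_{ℝ⁺})`,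
the energy is bounded from below on `H¹_μ(ℝ⁺)` by some `m < 0`, and the infimum is
achieved by some `u ∈ H¹_μ(ℝ⁺)` with strictly negative energy. -/
theorem focusing_ground_state_halfline (p α μ : ℝ)
    (hp : 2 < p) (hp' : p < 6) (hα : 0 < α)
    (hμ : 0 < μ) (hμR : μ < Real.pi * Real.sqrt 3 / 4) :
    (∃ m : ℝ, m < 0 ∧ ∀ u u' : ℝ → ℝ, H1halfline u u' →
      (∫ x in Set.Ioi (0 : ℝ), (u x) ^ 2) = μ → m ≤ Ehalfline p α u u') ∧
    (∃ u u' : ℝ → ℝ, H1halfline u u' ∧ (∫ x in Set.Ioi (0 : ℝ), (u x) ^ 2) = μ ∧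
      Ehalfline p α u u' < 0 ∧
      ∀ v v' : ℝ → ℝ, H1halfline v v' → (∫ x in Set.Ioi (0 : ℝ), (v x) ^ 2) = μ →
        Ehalfline p α u u' ≤ Ehalfline p α v v') := by
  have hc : 0 < 2 * α / p := by positivity
  obtain ⟨l, hl, hlμ⟩ := exists_solitonMass_eq hp hμ hμR
  obtain ⟨M₀, hM₀, hM₀l⟩ : ∃ M, 0 < M ∧ 2 * α / p * M ^ (p - 6) = l := by
    refine ⟨(l / (2 * α / p)) ^ (p - 6)⁻¹, by positivity, ?_⟩
    rw [Real.rpow_inv_rpow (by positivity) (by linarith), mul_div_cancel₀ _ hc.ne']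
  rw [← hM₀l] at hlμ
  obtain ⟨u, u', hu, hmass, hE⟩ := exists_soliton_H1halfline hp hα hM₀
  rw [hlμ] at hmass hE
  have htan := fun M hM => solitonAction_tangent (M := M) hp hp' hc hM₀ hM hlμ hμ
  have hmin : ∀ v v' : ℝ → ℝ, H1halfline v v' → (∫ x in Set.Ioi (0 : ℝ), (v x) ^ 2) = μ →
      Ehalfline p α u u' ≤ Ehalfline p α v v' := by
    intro v v' hv hvμ
    obtain ⟨M, hM, hle⟩ := hv.exists_le_energy hp hα hvμ
    linarith [htan M hM]
  have hneg : Ehalfline p α u u' < 0 := by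
    obtain ⟨M, hM, hlt⟩ := exists_solitonAction_neg hp hp' hc hμ
    linarith [htan M hM]
  exact ⟨⟨_, hneg, hmin⟩, u, u', hu, hmass, hneg, hmin⟩
end

section
/- Focusing case on the half-line, unboundedness at and above the critical mass: let p ∈ (2,6), α > 0 and μ ≥ μ_{ℝ⁺}. Then the NLS energy E_α(·, ℝ⁺) is unbounded from below on H¹_μ(ℝ⁺): for every M > 0 there exists u ∈ H¹_μ(ℝ⁺) with E_α(u, ℝ⁺) < −M. In particular this holds at the critical mass μ = μ_{ℝ⁺} itself. -/
open MeasureTheory Real Set Filter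

theorem tendsto_sinh_atTop : Tendsto Real.sinh atTop atTop := by
  refine tendsto_atTop_mono' atTop ?_ tendsto_id
  filter_upwards [eventually_ge_atTop 0] with x hx
  exact Real.self_le_sinh_iff.2 hx

theorem tendsto_arctan_sinh_atTop :
    Tendsto (fun x => arctan (Real.sinh x)) atTop (nhds (π / 2)) :=
  (tendsto_nhds_of_tendsto_nhdsWithin tendsto_arctan_atTop).comp tendsto_sinh_atTop

theorem tendsto_cosh_inv_atTop : Tendsto (fun x => (Real.cosh x)⁻¹) atTop (nhds 0) :=
  (tendsto_atTop_mono (fun x => (Real.sinh_lt_cosh x).le) tendsto_sinh_atTop).inv_tendsto_atTop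

theorem hasDerivAt_arctan_sinh (x : ℝ) :
    HasDerivAt (fun x => arctan (Real.sinh x)) (Real.cosh x)⁻¹ x := by
  convert (Real.hasDerivAt_sinh x).arctan using 1
  rw [← Real.cosh_sq' x]
  have := (Real.cosh_pos x).ne'
  field_simp

theorem hasDerivAt_sech_cube_primitive (x : ℝ) :
    HasDerivAt (fun x => (Real.sinh x / Real.cosh x ^ 2 + arctan (Real.sinh x)) / 2)
      ((Real.cosh x)⁻¹ ^ 3) x := by
  have hc := (Real.cosh_pos x).ne'
  have h := (((Real.hasDerivAt_sinh x).div ((Real.hasDerivAt_cosh x).pow 2)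
    (pow_ne_zero 2 hc)).add (hasDerivAt_arctan_sinh x)).div_const 2
  refine h.congr_deriv ?_
  have := Real.sinh_sq x
  simp only [Pi.pow_apply]
  field_simp
  norm_num
  linear_combination (-2 * Real.cosh x) * this

theorem tendsto_sech_cube_primitive :
    Tendsto (fun x => (Real.sinh x / Real.cosh x ^ 2 + arctan (Real.sinh x)) / 2) atTop
      (nhds (π / 4)) := by
  have h : Tendsto (fun x => Real.sinh x / Real.cosh x ^ 2) atTop (nhds 0) := by
    refine squeeze_zero' ?_ ?_ tendsto_cosh_inv_atTop
    · filter_upwards [eventually_ge_atTop 0] with x hx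
      exact div_nonneg (Real.sinh_nonneg_iff.2 hx) (by positivity)
    · refine Eventually.of_forall fun x => ?_
      have hc := Real.cosh_pos x
      rw [div_le_iff₀ (by positivity)]
      have : (Real.cosh x)⁻¹ * Real.cosh x ^ 2 = Real.cosh x := by field_simp
      rw [this]
      exact (Real.sinh_lt_cosh x).le
  convert (h.add tendsto_arctan_sinh_atTop).div_const 2 using 2
  ring

theorem integrableOn_sech : IntegrableOn (fun x => (Real.cosh x)⁻¹) (Ioi 0) :=
  integrableOn_Ioi_deriv_of_nonneg' (fun x _ => hasDerivAt_arctan_sinh x)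
    (fun x _ => by have := Real.cosh_pos x; positivity) tendsto_arctan_sinh_atTop

theorem integral_sech : ∫ x in Ioi (0 : ℝ), (Real.cosh x)⁻¹ = π / 2 := by
  rw [integral_Ioi_of_hasDerivAt_of_nonneg' (fun x _ => hasDerivAt_arctan_sinh x)
    (fun x _ => by have := Real.cosh_pos x; positivity) tendsto_arctan_sinh_atTop]
  simp

theorem integrableOn_sech_cube : IntegrableOn (fun x => (Real.cosh x)⁻¹ ^ 3) (Ioi 0) :=
  integrableOn_Ioi_deriv_of_nonneg' (fun x _ => hasDerivAt_sech_cube_primitive x)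
    (fun x _ => by have := Real.cosh_pos x; positivity) tendsto_sech_cube_primitive

theorem integral_sech_cube : ∫ x in Ioi (0 : ℝ), (Real.cosh x)⁻¹ ^ 3 = π / 4 := by
  rw [integral_Ioi_of_hasDerivAt_of_nonneg' (fun x _ => hasDerivAt_sech_cube_primitive x)
    (fun x _ => by have := Real.cosh_pos x; positivity) tendsto_sech_cube_primitive]
  simp

theorem integrableOn_sech_rpow {q : ℝ} (hq : 1 ≤ q) :
    IntegrableOn (fun x => (Real.cosh x)⁻¹ ^ q) (Ioi 0) := by
  refine Integrable.mono' integrableOn_sech ?_ (Eventually.of_forall fun x => ?_)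
  · refine Continuous.aestronglyMeasurable ?_
    exact (Real.continuous_cosh.inv₀ fun x => (Real.cosh_pos x).ne').rpow_const
      fun x => Or.inr (by linarith)
  · have hc := Real.cosh_pos x
    rw [Real.norm_of_nonneg (by positivity)]
    exact Real.rpow_le_self_of_le_one (by positivity) (inv_le_one_of_one_le₀ (Real.one_le_cosh x)) hq

theorem integral_sech_rpow_pos {q : ℝ} (hq : 1 ≤ q) :
    0 < ∫ x in Ioi (0 : ℝ), (Real.cosh x)⁻¹ ^ q := by
  have hpos : ∀ x : ℝ, 0 < (Real.cosh x)⁻¹ ^ q := fun x => by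
    have := Real.cosh_pos x; positivity
  rw [setIntegral_pos_iff_support_of_nonneg_ae (Eventually.of_forall fun x => (hpos x).le)
    (integrableOn_sech_rpow hq)]
  have : Function.support (fun x : ℝ => (Real.cosh x)⁻¹ ^ q) = univ :=
    eq_univ_of_forall fun x => (hpos x).ne'
  rw [this]
  simp

theorem integrableOn_Ioi_comp_mul {f : ℝ → ℝ} (hf : IntegrableOn f (Ioi 0)) {l : ℝ} (hl : 0 < l) :
    IntegrableOn (fun x => f (l * x)) (Ioi 0) := by
  rw [integrableOn_Ioi_comp_mul_left_iff f 0 hl]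
  simpa using hf

/-- The soliton profile `√(b l sech(l x))`, of mass `π b / 2` on the half-line. -/
noncomputable def soliton (b l x : ℝ) : ℝ := √(b * l * (Real.cosh (l * x))⁻¹)

/-- The derivative of `soliton b l`. -/
noncomputable def solitonDeriv (b l x : ℝ) : ℝ :=
  -(l / 2) * (Real.sinh (l * x) / Real.cosh (l * x)) * soliton b l x

section Soliton

variable {b l : ℝ}

theorem soliton_radicand_pos (hb : 0 < b) (hl : 0 < l) (x : ℝ) :
    0 < b * l * (Real.cosh (l * x))⁻¹ := by
  have := Real.cosh_pos (l * x)
  positivity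

theorem soliton_sq (hb : 0 < b) (hl : 0 < l) (x : ℝ) :
    soliton b l x ^ 2 = b * l * (Real.cosh (l * x))⁻¹ :=
  Real.sq_sqrt (soliton_radicand_pos hb hl x).le

theorem solitonDeriv_sq (hb : 0 < b) (hl : 0 < l) (x : ℝ) :
    solitonDeriv b l x ^ 2 =
      b * l ^ 3 / 4 * ((Real.cosh (l * x))⁻¹ - (Real.cosh (l * x))⁻¹ ^ 3) := by
  rw [solitonDeriv, mul_pow, soliton_sq hb hl]
  have hc := (Real.cosh_pos (l * x)).ne'
  have hs := Real.sinh_sq (l * x)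
  field_simp
  linear_combination 4 * hs

theorem abs_soliton_pow_six (hb : 0 < b) (hl : 0 < l) (x : ℝ) :
    |soliton b l x| ^ 6 = b ^ 3 * l ^ 3 * (Real.cosh (l * x))⁻¹ ^ 3 := by
  rw [show 6 = 2 * 3 from rfl, pow_mul, sq_abs, soliton_sq hb hl]
  ring

theorem abs_soliton_rpow (hb : 0 < b) (hl : 0 < l) (p x : ℝ) :
    |soliton b l x| ^ p = (b * l) ^ (p / 2) * (Real.cosh (l * x))⁻¹ ^ (p / 2) := by
  have hc := Real.cosh_pos (l * x)
  have hr := soliton_radicand_pos hb hl x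
  rw [soliton, abs_of_nonneg (Real.sqrt_nonneg _), Real.sqrt_eq_rpow, ← Real.rpow_mul hr.le,
    ← Real.mul_rpow (by positivity) (by positivity)]
  congr 1
  ring

theorem hasDerivAt_soliton (hb : 0 < b) (hl : 0 < l) (x : ℝ) :
    HasDerivAt (soliton b l) (solitonDeriv b l x) x := by
  have hc := Real.cosh_pos (l * x)
  have hr := soliton_radicand_pos hb hl x
  have hin : HasDerivAt (fun x => l * x) l x := by simpa using (hasDerivAt_id x).const_mul l
  have h := ((((Real.hasDerivAt_cosh (l * x)).comp x hin).inv hc.ne').const_mul (b * l)).sqrt hr.ne'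
  refine h.congr_deriv ?_
  have hs : 0 < soliton b l x := Real.sqrt_pos.2 hr
  have hsq := soliton_sq hb hl x
  change _ / (2 * soliton b l x) = _
  rw [solitonDeriv, div_eq_iff (by positivity)]
  have : -(l / 2) * (Real.sinh (l * x) / Real.cosh (l * x)) * soliton b l x *
      (2 * soliton b l x) =
      -l * (Real.sinh (l * x) / Real.cosh (l * x)) * soliton b l x ^ 2 := by ring
  rw [this, hsq]
  simp only [Function.comp_apply]
  field_simp

theorem H1halfline_soliton (hb : 0 < b) (hl : 0 < l) :
    H1halfline (soliton b l) (solitonDeriv b l) := by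
  refine ⟨fun x _ => (hasDerivAt_soliton hb hl x).continuousAt.continuousWithinAt,
    fun x _ => hasDerivAt_soliton hb hl x, ?_, ?_⟩
  · simp only [soliton_sq hb hl]
    exact (integrableOn_Ioi_comp_mul integrableOn_sech hl).const_mul _
  · simp only [solitonDeriv_sq hb hl]
    exact ((integrableOn_Ioi_comp_mul integrableOn_sech hl).sub
      (integrableOn_Ioi_comp_mul integrableOn_sech_cube hl)).const_mul _

theorem integral_soliton_sq (hb : 0 < b) (hl : 0 < l) :
    ∫ x in Ioi (0 : ℝ), soliton b l x ^ 2 = b * (π / 2) := by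
  simp only [soliton_sq hb hl]
  rw [integral_const_mul, integral_comp_mul_left_Ioi (fun x => (Real.cosh x)⁻¹) 0 hl, mul_zero,
    integral_sech, smul_eq_mul]
  field_simp

theorem Ehalfline_soliton (hb : 0 < b) (hl : 0 < l) {p : ℝ} (hp : 2 < p) (α : ℝ) :
    Ehalfline p α (soliton b l) (solitonDeriv b l) =
      l ^ 2 * (π / 32) * b * (1 - 4 / 3 * b ^ 2) -
        α / p * b ^ (p / 2) * (∫ x in Ioi (0 : ℝ), (Real.cosh x)⁻¹ ^ (p / 2)) *
          l ^ (p / 2 - 1) := by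
  have h1 := integrableOn_Ioi_comp_mul integrableOn_sech hl
  have h3 := integrableOn_Ioi_comp_mul integrableOn_sech_cube hl
  have hq := integrableOn_Ioi_comp_mul (integrableOn_sech_rpow (q := p / 2) (by linarith)) hl
  have i1 := integral_comp_mul_left_Ioi (fun x => (Real.cosh x)⁻¹) 0 hl
  have i3 := integral_comp_mul_left_Ioi (fun x => (Real.cosh x)⁻¹ ^ 3) 0 hl
  have iq := integral_comp_mul_left_Ioi (fun x => (Real.cosh x)⁻¹ ^ (p / 2)) 0 hl
  rw [mul_zero, smul_eq_mul] at i1 i3 iq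
  rw [integral_sech] at i1
  rw [integral_sech_cube] at i3
  have hfun : ∀ x : ℝ, 1 / 2 * solitonDeriv b l x ^ 2 - 1 / 6 * |soliton b l x| ^ 6 -
      α / p * |soliton b l x| ^ p =
      b * l ^ 3 / 8 * (Real.cosh (l * x))⁻¹ -
        (b * l ^ 3 / 8 + b ^ 3 * l ^ 3 / 6) * (Real.cosh (l * x))⁻¹ ^ 3 -
        α / p * (b * l) ^ (p / 2) * (Real.cosh (l * x))⁻¹ ^ (p / 2) := fun x => by
    rw [solitonDeriv_sq hb hl, abs_soliton_pow_six hb hl, abs_soliton_rpow hb hl]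
    ring
  have h13 : IntegrableOn (fun x => b * l ^ 3 / 8 * (Real.cosh (l * x))⁻¹ -
      (b * l ^ 3 / 8 + b ^ 3 * l ^ 3 / 6) * (Real.cosh (l * x))⁻¹ ^ 3) (Ioi 0) :=
    (h1.const_mul _).sub (h3.const_mul _)
  simp only [Ehalfline, hfun]
  rw [integral_sub h13 (hq.const_mul _),
    integral_sub (h1.const_mul _) (h3.const_mul _), integral_const_mul, integral_const_mul,
    integral_const_mul, i1, i3, iq, Real.mul_rpow hb.le hl.le, Real.rpow_sub_one hl.ne']
  field_simp
  ring

end Soliton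

/-- Focusing case on the half-line, unboundedness at and above the critical mass
`μ_{ℝ⁺} = π√3/4`: for `p ∈ (2,6)`, `α > 0` and `μ ≥ μ_{ℝ⁺}`, for every `M > 0`
there exists `u ∈ H¹_μ(ℝ⁺)` with `E_α(u, ℝ⁺) < −M`. -/
theorem focusing_unbounded_halfline (p α μ : ℝ)
    (hp : 2 < p) (hp' : p < 6) (hα : 0 < α)
    (hμ : Real.pi * Real.sqrt 3 / 4 ≤ μ) :
    ∀ M : ℝ, 0 < M → ∃ u u' : ℝ → ℝ,
      H1halfline u u' ∧ (∫ x in Set.Ioi (0 : ℝ), (u x) ^ 2) = μ ∧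
        Ehalfline p α u u' < -M := by
  intro M _
  have hπ := Real.pi_pos
  obtain ⟨b, rfl⟩ : ∃ b, b * (π / 2) = μ := ⟨μ / (π / 2), by field_simp⟩
  have hbs : √3 / 2 ≤ b := by
    refine le_of_mul_le_mul_right ?_ (half_pos hπ)
    linarith
  have hs : 0 < √3 := by positivity
  have hb : 0 < b := by linarith
  have hb2 : 3 / 4 ≤ b ^ 2 := by
    nlinarith [Real.sq_sqrt (show (0 : ℝ) ≤ 3 by norm_num)]
  have hJ := integral_sech_rpow_pos (q := p / 2) (by linarith)
  have hC : 0 < α / p * b ^ (p / 2) * ∫ x in Ioi (0 : ℝ), (Real.cosh x)⁻¹ ^ (p / 2) := by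
    have : 0 < p := by linarith
    positivity
  have hlim := (tendsto_rpow_atTop (show 0 < p / 2 - 1 by linarith)).const_mul_atTop hC
  obtain ⟨l, hlM, hl⟩ := ((hlim.eventually_gt_atTop M).and (eventually_gt_atTop 0)).exists
  refine ⟨soliton b l, solitonDeriv b l, H1halfline_soliton hb hl, integral_soliton_sq hb hl, ?_⟩
  rw [Ehalfline_soliton hb hl hp]
  have hle : l ^ 2 * (π / 32) * b * (1 - 4 / 3 * b ^ 2) ≤ 0 :=
    mul_nonpos_of_nonneg_of_nonpos (by positivity) (by linarith)
  linarith
end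

section
/- Strict comparison between the half-line and the line ground state levels: let p ∈ (2,6), α > 0 and μ ∈ (0, μ_{ℝ⁺}). Then ℰ_α(μ, ℝ⁺) < ℰ_α(μ, ℝ), i.e. the infimum of the NLS energy over H¹_μ(ℝ⁺) is strictly smaller than the infimum of the NLS energy over H¹_μ(ℝ). -/
open MeasureTheory Real Set Filter

/-- Membership in `H¹(ℝ)`: `u` is differentiable with derivative `u'`,
and both `u` and `u'` are square-integrable on `ℝ`. -/
def H1line (u u' : ℝ → ℝ) : Prop :=
  (∀ x, HasDerivAt u (u' x) x) ∧
  Integrable (fun x => (u x) ^ 2) ∧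
  Integrable (fun x => (u' x) ^ 2)

/-- The NLS energy with combined nonlinearities on the line. -/
noncomputable def Eline (p α : ℝ) (u u' : ℝ → ℝ) : ℝ :=
  ∫ x, (1 / 2 * (u' x) ^ 2 - 1 / 6 * |u x| ^ 6 - α / p * |u x| ^ p)

/-- The ground state energy level `ℰ_α(μ, ℝ)`. -/
noncomputable def glevelLine (p α μ : ℝ) : ℝ :=
  sInf {e : ℝ | ∃ u u' : ℝ → ℝ, H1line u u' ∧ (∫ x, (u x) ^ 2) = μ ∧ Eline p α u u' = e}

/-- The ground state energy level `ℰ_α(μ, ℝ⁺)`. -/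
noncomputable def glevelHalfline (p α μ : ℝ) : ℝ :=
  sInf {e : ℝ | ∃ u u' : ℝ → ℝ, H1halfline u u' ∧
    (∫ x in Set.Ioi (0 : ℝ), (u x) ^ 2) = μ ∧ Ehalfline p α u u' = e}

namespace H1halfline

variable {u u' : ℝ → ℝ}

lemma aestronglyMeasurable (h : H1halfline u u') :
    AEStronglyMeasurable u (volume.restrict (Ioi 0)) :=
  (h.1.mono Ioi_subset_Ici_self).aestronglyMeasurable measurableSet_Ioi

lemma aestronglyMeasurable_deriv (h : H1halfline u u') :
    AEStronglyMeasurable u' (volume.restrict (Ioi 0)) := by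
  refine (measurable_deriv u).aestronglyMeasurable.congr ?_
  filter_upwards [ae_restrict_mem measurableSet_Ioi] with x hx
  exact (h.2.1 x hx).deriv

lemma integrableOn_mul_deriv (h : H1halfline u u') :
    IntegrableOn (fun x => u x * u' x) (Ioi 0) := by
  refine Integrable.mono' (h.2.2.1.add h.2.2.2)
    (h.aestronglyMeasurable.mul h.aestronglyMeasurable_deriv) (ae_of_all _ fun x => ?_)
  rw [Real.norm_eq_abs, abs_le]
  simp only [Pi.add_apply]
  constructor <;> nlinarith [sq_nonneg (u x + u' x), sq_nonneg (u x - u' x)]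

lemma tendsto_sq_zero (h : H1halfline u u') :
    Tendsto (fun x => u x ^ 2) atTop (nhds 0) := by
  refine tendsto_zero_of_hasDerivAt_of_integrableOn_Ioi (a := 0)
    (f' := fun x => 2 * (u x * u' x)) (fun x hx => ?_)
    (h.integrableOn_mul_deriv.const_mul 2) h.2.2.1
  exact ((h.2.1 x hx).fun_pow 2).congr_deriv (by push_cast; ring)

lemma exists_sq_le (h : H1halfline u u') : ∃ B : ℝ, 0 < B ∧ ∀ x, 0 ≤ x → u x ^ 2 ≤ B := by
  obtain ⟨X, hX⟩ := eventually_atTop.1 (h.tendsto_sq_zero.eventually_le_const one_pos)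
  obtain ⟨B, hB⟩ := isCompact_Icc.exists_bound_of_continuousOn
    ((h.1.mono (Icc_subset_Ici_self : Icc 0 X ⊆ Ici 0)).pow 2)
  refine ⟨max B 1, by positivity, fun x hx => ?_⟩
  rcases le_total x X with hxX | hxX
  · exact (le_abs_self _).trans ((hB x ⟨hx, hxX⟩).trans (le_max_left _ _))
  · exact (hX x hxX).trans (le_max_right _ _)

lemma integrableOn_pow_six_s12 (h : H1halfline u u') :
    IntegrableOn (fun x => |u x| ^ 6) (Ioi 0) := by
  obtain ⟨B, hB, hb⟩ := h.exists_sq_le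
  refine Integrable.mono' (h.2.2.1.const_mul (B ^ 2))
    ((h.aestronglyMeasurable.norm.pow 6)) ?_
  filter_upwards [ae_restrict_mem measurableSet_Ioi] with x hx
  have h1 := hb x (le_of_lt hx)
  have h2 : (u x ^ 2) ^ 2 ≤ B ^ 2 := pow_le_pow_left₀ (sq_nonneg _) h1 2
  rw [Real.norm_of_nonneg (by positivity)]
  calc |u x| ^ 6 = (|u x| ^ 2) ^ 2 * |u x| ^ 2 := by ring
    _ = (u x ^ 2) ^ 2 * u x ^ 2 := by rw [sq_abs]
    _ ≤ _ := mul_le_mul_of_nonneg_right h2 (sq_nonneg _)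

end H1halfline

lemma abs_rpow_le_add {p R : ℝ} (hp : 2 < p) (hp' : p < 6) (hR : 0 < R) (s : ℝ) :
    |s| ^ p ≤ R ^ (p - 2) * s ^ 2 + R ^ (p - 6) * |s| ^ 6 := by
  rcases eq_or_ne s 0 with rfl | hs
  · simp [Real.zero_rpow (by linarith : p ≠ 0)]
  have hs : 0 < |s| := abs_pos.2 hs
  rcases le_total |s| R with hle | hle
  · have h1 : |s| ^ p = |s| ^ (p - 2) * s ^ 2 := by
      rw [← sq_abs s, ← Real.rpow_natCast |s| 2, ← Real.rpow_add hs]; norm_num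
    have h2 : |s| ^ (p - 2) ≤ R ^ (p - 2) := Real.rpow_le_rpow hs.le hle (by linarith)
    rw [h1]
    have : 0 ≤ R ^ (p - 6) * |s| ^ 6 := by positivity
    nlinarith [mul_le_mul_of_nonneg_right h2 (sq_nonneg s)]
  · have h1 : |s| ^ p = |s| ^ (p - 6) * |s| ^ 6 := by
      rw [← Real.rpow_natCast |s| 6, ← Real.rpow_add hs]; norm_num
    have h2 : |s| ^ (p - 6) ≤ R ^ (p - 6) :=
      Real.rpow_le_rpow_of_nonpos hR hle (by linarith)
    rw [h1]
    have : 0 ≤ R ^ (p - 2) * s ^ 2 := by positivity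
    nlinarith [mul_le_mul_of_nonneg_right h2 (by positivity : 0 ≤ |s| ^ 6)]

namespace H1halfline

variable {u u' : ℝ → ℝ} {p : ℝ}

lemma integrableOn_rpow_s12 (h : H1halfline u u') (hp : 2 < p) (hp' : p < 6) :
    IntegrableOn (fun x => |u x| ^ p) (Ioi 0) := by
  refine Integrable.mono' (h.2.2.1.add h.integrableOn_pow_six_s12) ?_ (ae_of_all _ fun x => ?_)
  · exact (h.aestronglyMeasurable.norm.aemeasurable.pow_const p).aestronglyMeasurable
  · rw [Real.norm_of_nonneg (by positivity)]
    simpa using abs_rpow_le_add hp hp' one_pos (u x)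

lemma integrableOn_density (h : H1halfline u u') (hp : 2 < p) (hp' : p < 6) (k α : ℝ) :
    IntegrableOn (fun x => k * u' x ^ 2 - 1 / 6 * |u x| ^ 6 - α / p * |u x| ^ p) (Ioi 0) :=
  ((h.2.2.2.const_mul k).sub (h.integrableOn_pow_six_s12.const_mul _)).sub
    ((h.integrableOn_rpow_s12 hp hp').const_mul _)

lemma integral_density (h : H1halfline u u') (hp : 2 < p) (hp' : p < 6) (k α : ℝ) :
    ∫ x in Ioi 0, (k * u' x ^ 2 - 1 / 6 * |u x| ^ 6 - α / p * |u x| ^ p) =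
      k * (∫ x in Ioi 0, u' x ^ 2) - 1 / 6 * (∫ x in Ioi 0, |u x| ^ 6)
        - α / p * ∫ x in Ioi 0, |u x| ^ p := by
  have e := integral_sub ((h.2.2.2.const_mul k).sub (h.integrableOn_pow_six_s12.const_mul (1 / 6)))
    ((h.integrableOn_rpow_s12 hp hp').const_mul (α / p))
  simp only [Pi.sub_apply] at e
  rw [e, integral_sub (h.2.2.2.const_mul k) (h.integrableOn_pow_six_s12.const_mul _),
    integral_const_mul, integral_const_mul, integral_const_mul]

lemma integral_rpow_le (h : H1halfline u u') (hp : 2 < p) (hp' : p < 6) {R : ℝ} (hR : 0 < R) :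
    ∫ x in Ioi 0, |u x| ^ p ≤
      R ^ (p - 2) * (∫ x in Ioi 0, u x ^ 2) + R ^ (p - 6) * ∫ x in Ioi 0, |u x| ^ 6 := by
  rw [← integral_const_mul, ← integral_const_mul,
    ← integral_add (h.2.2.1.const_mul _) (h.integrableOn_pow_six_s12.const_mul _)]
  exact setIntegral_mono (h.integrableOn_rpow_s12 hp hp')
    ((h.2.2.1.const_mul _).add (h.integrableOn_pow_six_s12.const_mul _))
    (fun x => abs_rpow_le_add hp hp' hR (u x))

lemma const_mul (h : H1halfline u u') (c : ℝ) :
    H1halfline (fun x => c * u x) (fun x => c * u' x) := by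
  refine ⟨continuousOn_const.mul h.1, fun x hx => (h.2.1 x hx).const_mul c, ?_, ?_⟩
  · simpa only [mul_pow] using! h.2.2.1.const_mul (c ^ 2)
  · simpa only [mul_pow] using! h.2.2.2.const_mul (c ^ 2)

/-- The critical Gagliardo-Nirenberg inequality on the half-line below the critical mass, by
calibration: with `θ x = 2 / √3 * (M - ∫₀ˣ u²)`, the sum of
`u'² / 2 - u⁶ / 6` and of the derivative of `u⁴ * cot θ / (4 * √3)` is a square. -/
lemma integral_pow_six_le (h : H1halfline u u')
    (hm : ∫ x in Ioi 0, u x ^ 2 < π * √3 / 4) :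
    ∫ x in Ioi 0, |u x| ^ 6 ≤ 3 * ∫ x in Ioi 0, u' x ^ 2 := by
  set m := ∫ x in Ioi 0, u x ^ 2
  obtain ⟨M, hmM, hM⟩ := exists_between hm
  have s3 : (0 : ℝ) < √3 := by positivity
  have s3sq : √3 ^ 2 = (3 : ℝ) := Real.sq_sqrt (by norm_num)
  have hVc : Continuous fun x => u (max x 0) :=
    h.1.comp_continuous (by fun_prop) fun x => le_max_right x 0
  set N : ℝ → ℝ := fun x => ∫ t in (0 : ℝ)..x, u (max t 0) ^ 2 with hN
  have hNd : ∀ x, HasDerivAt N (u (max x 0) ^ 2) x := fun x =>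
    ((hVc.pow 2).integral_hasStrictDerivAt 0 x).hasDerivAt
  have hN0 : ∀ x, 0 ≤ x → 0 ≤ N x := fun x hx =>
    intervalIntegral.integral_nonneg hx fun t _ => sq_nonneg _
  have hNm : ∀ x, 0 ≤ x → N x ≤ m := by
    intro x hx
    simp only [hN]
    rw [intervalIntegral.integral_of_le hx]
    calc ∫ t in Ioc 0 x, u (max t 0) ^ 2 = ∫ t in Ioc 0 x, u t ^ 2 :=
          setIntegral_congr_fun measurableSet_Ioc fun t ht => by
            simp only [max_eq_left ht.1.le]
      _ ≤ m := setIntegral_mono_set h.2.2.1 (ae_of_all _ fun t => sq_nonneg _)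
            (Ioc_subset_Ioi_self.eventuallyLE)
  set θ : ℝ → ℝ := fun x => 2 / √3 * (M - N x) with hθ
  have hθd : ∀ x, HasDerivAt θ (2 / √3 * -(u (max x 0) ^ 2)) x := fun x =>
    ((hNd x).const_sub M).const_mul _
  have hθc : Continuous θ := continuous_iff_continuousAt.2 fun x => (hθd x).continuousAt
  set η := 2 / √3 * (M - m)
  have hη0 : 0 < η := by have := sub_pos.2 hmM; positivity
  have hθη : ∀ x, 0 ≤ x → η ≤ θ x := fun x hx =>
    mul_le_mul_of_nonneg_left (by linarith [hNm x hx]) (by positivity)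
  have hθ2 : ∀ x, 0 ≤ x → θ x ≤ π / 2 := by
    intro x hx
    have : θ x ≤ 2 / √3 * (π * √3 / 4) :=
      mul_le_mul_of_nonneg_left (by linarith [hN0 x hx]) (by positivity)
    refine this.trans_eq ?_
    field_simp; norm_num
  have hsη : 0 < sin η := by
    have h0 := hθη 0 le_rfl
    have h1 := hθ2 0 le_rfl
    exact sin_pos_of_pos_of_lt_pi hη0 (by linarith [pi_pos])
  have hs : ∀ x, 0 ≤ x → sin η ≤ sin (θ x) := fun x hx =>
    sin_le_sin_of_le_of_le_pi_div_two (by linarith [pi_pos]) (hθ2 x hx) (hθη x hx)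
  set c : ℝ → ℝ := fun x => cos (θ x) / sin (θ x) with hc
  have hc0 : ∀ x, 0 ≤ x → 0 ≤ c x := fun x hx =>
    div_nonneg (cos_nonneg_of_mem_Icc ⟨by linarith [hθη x hx, pi_pos], hθ2 x hx⟩)
      (hsη.le.trans (hs x hx))
  have hcK : ∀ x, 0 ≤ x → c x ≤ 1 / sin η := fun x hx =>
    div_le_div₀ zero_le_one (cos_le_one _) hsη (hs x hx)
  have hcd : ∀ x, 0 < x → HasDerivAt c (2 / √3 * u x ^ 2 * (1 + c x ^ 2)) x := by
    intro x hx
    have hsx : sin (θ x) ≠ 0 := (hsη.trans_le (hs x hx.le)).ne'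
    refine (((hθd x).cos).fun_div ((hθd x).sin) hsx).congr_deriv ?_
    rw [max_eq_left hx.le]
    simp only [hc]
    field_simp
    ring
  have hcc : ContinuousOn c (Ici 0) := ((continuous_cos.comp hθc).continuousOn).div
    ((continuous_sin.comp hθc).continuousOn) fun x hx => (hsη.trans_le (hs x hx)).ne'
  set g : ℝ → ℝ := fun x => 1 / (4 * √3) * (u x ^ 4 * c x) with hg
  set g' : ℝ → ℝ := fun x => 1 / (4 * √3) *
    (4 * u x ^ 3 * u' x * c x + u x ^ 4 * (2 / √3 * u x ^ 2 * (1 + c x ^ 2))) with hg'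
  have hgd : ∀ x ∈ Ioi (0 : ℝ), HasDerivAt g (g' x) x := by
    intro x hx
    exact ((((h.2.1 x hx).fun_pow 4).fun_mul (hcd x hx)).const_mul
      (1 / (4 * √3))).congr_deriv (by simp [hg'])
  have hg0 : 0 ≤ g 0 := by have := hc0 0 le_rfl; simp only [hg]; positivity
  obtain ⟨B, hB, hb⟩ := h.exists_sq_le
  have hgi : IntegrableOn g' (Ioi 0) := by
    have hcm : AEStronglyMeasurable c (volume.restrict (Ioi 0)) :=
      (hcc.mono Ioi_subset_Ici_self).aestronglyMeasurable measurableSet_Ioi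
    have i1 : IntegrableOn (fun x => (u x ^ 2 * c x) * (u x * u' x)) (Ioi 0) := by
      refine h.integrableOn_mul_deriv.bdd_mul (c := B * (1 / sin η))
        ((h.aestronglyMeasurable.pow 2).mul hcm) ?_
      filter_upwards [ae_restrict_mem measurableSet_Ioi] with x hx
      have hx : 0 ≤ x := le_of_lt hx
      rw [Real.norm_of_nonneg (mul_nonneg (sq_nonneg _) (hc0 x hx))]
      exact mul_le_mul (hb x hx) (hcK x hx) (hc0 x hx) hB.le
    have i2 : IntegrableOn (fun x => (1 + c x ^ 2) * |u x| ^ 6) (Ioi 0) := by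
      refine h.integrableOn_pow_six_s12.bdd_mul (c := 1 + (1 / sin η) ^ 2)
        ((hcm.pow 2).const_add 1) ?_
      filter_upwards [ae_restrict_mem measurableSet_Ioi] with x hx
      have hx : 0 ≤ x := le_of_lt hx
      rw [Real.norm_of_nonneg (by positivity)]
      have := pow_le_pow_left₀ (hc0 x hx) (hcK x hx) 2
      linarith
    refine ((i1.const_mul (1 / √3)).add (i2.const_mul (1 / 6))).congr (ae_of_all _ fun x => ?_)
    have h6 : |u x| ^ 6 = u x ^ 6 := Even.pow_abs (by decide) _
    simp only [hg', Pi.add_apply, h6]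
    field_simp
    linear_combination 4 * u x ^ 6 * (1 + c x ^ 2) * s3sq
  have hgt : Tendsto g atTop (nhds 0) := by
    have h4 : Tendsto (fun x => 1 / (4 * √3) * ((u x ^ 2) ^ 2 * (1 / sin η))) atTop (nhds 0) := by
      simpa using ((h.tendsto_sq_zero.pow 2).mul_const (1 / sin η)).const_mul (1 / (4 * √3))
    refine tendsto_of_tendsto_of_tendsto_of_le_of_le' tendsto_const_nhds h4 ?_ ?_
    · filter_upwards [eventually_ge_atTop 0] with x hx
      have := hc0 x hx
      simp only [hg]; positivity
    · filter_upwards [eventually_ge_atTop 0] with x hx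
      simp only [hg]
      rw [← pow_mul]
      have := hcK x hx
      gcongr
  have hgz : ContinuousWithinAt g (Ici 0) 0 :=
    (continuousOn_const.mul ((h.1.pow 4).mul hcc)) 0 self_mem_Ici
  have hint := integral_Ioi_of_hasDerivAt_of_tendsto hgz hgd hgi hgt
  have hi := ((h.2.2.2.const_mul (1 / 2)).sub (h.integrableOn_pow_six_s12.const_mul (1 / 6)))
  have key : 0 ≤ ∫ x in Ioi 0, ((1 / 2 * u' x ^ 2 - 1 / 6 * |u x| ^ 6) + g' x) := by
    refine setIntegral_nonneg measurableSet_Ioi fun x _ => ?_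
    have h6 : |u x| ^ 6 = u x ^ 6 := Even.pow_abs (by decide) _
    have : (1 / 2 * u' x ^ 2 - 1 / 6 * |u x| ^ 6) + g' x
        = 1 / 2 * (u' x + c x * u x ^ 3 / √3) ^ 2 := by
      simp only [hg', h6]
      field_simp
      linear_combination -8 * u x ^ 6 * s3sq
    rw [this]; positivity
  have e1 := integral_add hi hgi
  have e2 := integral_sub (h.2.2.2.const_mul (1 / 2)) (h.integrableOn_pow_six_s12.const_mul (1 / 6))
  simp only [Pi.sub_apply] at e1
  rw [e1, e2, hint, integral_const_mul, integral_const_mul] at key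
  linarith

lemma exists_coercive {μ : ℝ} (hμ : 0 < μ) (hμR : μ < π * √3 / 4) :
    ∃ κ : ℝ, 0 < κ ∧ κ < 1 ∧ ∀ u u' : ℝ → ℝ, H1halfline u u' → ∫ x in Ioi 0, u x ^ 2 = μ →
      ∫ x in Ioi 0, |u x| ^ 6 ≤ 3 * κ * ∫ x in Ioi 0, u' x ^ 2 := by
  obtain ⟨M, hM, hMR⟩ := exists_between hμR
  have hr : 1 < M / μ := (one_lt_div hμ).2 hM
  have hr0 : 0 < M / μ := by linarith
  refine ⟨(μ / M) ^ 2, by have := hμ.trans hM; positivity, ?_, fun u u' h hm => ?_⟩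
  · exact pow_lt_one₀ (by have := hμ.trans hM; positivity) ((div_lt_one (hμ.trans hM)).2 hM)
      two_ne_zero
  have hc2 : √(M / μ) ^ 2 = M / μ := Real.sq_sqrt hr0.le
  have hc6 : √(M / μ) ^ 6 = (M / μ) ^ 3 := by
    rw [show 6 = 2 * 3 from rfl, pow_mul, hc2]
  have := (h.const_mul √(M / μ)).integral_pow_six_le (by
    simp only [mul_pow, integral_const_mul, hm, hc2]
    rwa [div_mul_cancel₀ _ hμ.ne'])
  simp only [abs_mul, mul_pow, integral_const_mul, hc2, abs_of_nonneg (Real.sqrt_nonneg _),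
    hc6] at this
  have hM0 := hμ.trans hM
  have e : (M / μ) ^ 3 * (μ / M) ^ 3 = 1 := by field_simp
  have e' : (M / μ) * (μ / M) ^ 3 = (μ / M) ^ 2 := by field_simp
  have h3 := mul_le_mul_of_nonneg_right this (by positivity : 0 ≤ (μ / M) ^ 3)
  calc _ = (M / μ) ^ 3 * (μ / M) ^ 3 * ∫ x in Ioi 0, |u x| ^ 6 := by rw [e, one_mul]
    _ = (M / μ) ^ 3 * (∫ x in Ioi 0, |u x| ^ 6) * (μ / M) ^ 3 := by ring
    _ ≤ _ := h3
    _ = 3 * ((M / μ) * (μ / M) ^ 3) * ∫ x in Ioi 0, u' x ^ 2 := by ring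
    _ = _ := by rw [e']

end H1halfline

lemma exists_rpow_lt {q ε : ℝ} (hq : 0 < q) (hε : 0 < ε) : ∃ r : ℝ, 0 < r ∧ r ^ q < ε :=
  ⟨(ε / 2) ^ q⁻¹, by positivity, by
    rw [Real.rpow_inv_rpow (by positivity) hq.ne']; exact half_lt_self hε⟩

lemma exists_rpow_neg_lt {q ε : ℝ} (hq : q < 0) (hε : 0 < ε) : ∃ R : ℝ, 0 < R ∧ R ^ q < ε := by
  obtain ⟨r, hr, h⟩ := exists_rpow_lt (neg_pos.2 hq) hε
  exact ⟨r⁻¹, inv_pos.2 hr, by rwa [Real.inv_rpow hr.le, ← Real.rpow_neg hr.le]⟩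

lemma bddBelow_Ehalfline {p α μ : ℝ} (hp : 2 < p) (hp' : p < 6) (hα : 0 < α) (hμ : 0 < μ)
    (hμR : μ < π * √3 / 4) :
    BddBelow {e : ℝ | ∃ u u' : ℝ → ℝ, H1halfline u u' ∧
      (∫ x in Ioi (0 : ℝ), u x ^ 2) = μ ∧ Ehalfline p α u u' = e} := by
  obtain ⟨κ, hκ, hκ1, hGN⟩ := H1halfline.exists_coercive hμ hμR
  have hp0 : 0 < p := by linarith
  obtain ⟨R, hR, hRε⟩ := exists_rpow_neg_lt (q := p - 6) (by linarith)
    (by have := sub_pos.2 hκ1; positivity : 0 < (1 - κ) / (6 * κ * (α / p)))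
  rw [lt_div_iff₀ (by positivity)] at hRε
  refine ⟨-(α / p * (R ^ (p - 2) * μ)), ?_⟩
  rintro _ ⟨u, u', h, hm, rfl⟩
  have hQ := hGN u u' h hm
  have hP := mul_le_mul_of_nonneg_left (h.integral_rpow_le hp hp' hR)
    (by positivity : 0 ≤ α / p)
  have hT : 0 ≤ ∫ x in Ioi 0, u' x ^ 2 := integral_nonneg fun x => sq_nonneg _
  have hQ' := mul_le_mul_of_nonneg_left hQ (by positivity : 0 ≤ α / p * R ^ (p - 6))
  have hRT := mul_le_mul_of_nonneg_right hRε.le hT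
  rw [hm] at hP
  rw [Ehalfline, h.integral_density hp hp']
  linarith

lemma glevelHalfline_neg {p α μ : ℝ} (hp : 2 < p) (hp' : p < 6) (hα : 0 < α) (hμ : 0 < μ)
    (hμR : μ < π * √3 / 4) : glevelHalfline p α μ < 0 := by
  have hp0 : 0 < p := by linarith
  obtain ⟨k, hk, hkε⟩ := exists_rpow_lt (q := 3 - p / 2) (by linarith)
    (by positivity : 0 < α / p * ((2 * μ) ^ (p / 2) / p) / (μ / 2))
  rw [lt_div_iff₀ (by positivity)] at hkε
  set A := √(2 * k * μ) with hA
  have hA0 : 0 < A := by positivity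
  have hA2 : A ^ 2 = 2 * k * μ := Real.sq_sqrt (by positivity)
  have hAp : A ^ p = (2 * μ) ^ (p / 2) * k ^ (p / 2) := by
    rw [hA, Real.sqrt_eq_rpow, ← Real.rpow_mul (by positivity),
      ← Real.mul_rpow (by positivity) hk.le]
    congr 1 <;> ring
  have hsq : ∀ x, rexp (-k * x) ^ 2 = rexp (-(2 * k) * x) := fun x => by
    rw [← Real.exp_nat_mul]; push_cast; ring_nf
  have h2k : -(2 * k) < 0 := by linarith
  have hint : IntegrableOn (fun x => rexp (-k * x) ^ 2) (Ioi 0) := by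
    simpa only [hsq] using integrableOn_exp_mul_Ioi h2k 0
  have hval : ∫ x in Ioi 0, rexp (-k * x) ^ 2 = 1 / (2 * k) := by
    simp only [hsq, integral_exp_mul_Ioi h2k]
    simp
  set u : ℝ → ℝ := fun x => A * rexp (-k * x) with hu
  set u' : ℝ → ℝ := fun x => -k * A * rexp (-k * x) with hu'
  have h : H1halfline u u' := by
    refine ⟨by fun_prop, fun x _ => ?_, ?_, ?_⟩
    · exact ((((hasDerivAt_id' x).const_mul (-k)).exp).const_mul A).congr_deriv
        (by simp only [hu']; ring)
    · simpa only [hu, mul_pow] using! hint.const_mul (A ^ 2)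
    · simpa only [hu', mul_pow] using! hint.const_mul ((-k) ^ 2 * A ^ 2)
  have hm : ∫ x in Ioi 0, u x ^ 2 = μ := by
    simp only [hu, mul_pow, integral_const_mul, hval, hA2]
    field_simp
  have hT : ∫ x in Ioi 0, u' x ^ 2 = k ^ 2 * μ := by
    simp only [hu', mul_pow, integral_const_mul, hval, hA2]
    field_simp
  have hP : ∫ x in Ioi 0, |u x| ^ p = A ^ p * (1 / (p * k)) := by
    have hpk : -(p * k) < 0 := by have := mul_pos hp0 hk; linarith
    have e : ∀ x, |u x| ^ p = A ^ p * rexp (-(p * k) * x) := fun x => by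
      rw [abs_of_nonneg (by positivity), Real.mul_rpow hA0.le (Real.exp_pos _).le,
        ← Real.exp_mul]
      ring_nf
    simp only [e, integral_const_mul, integral_exp_mul_Ioi hpk]
    simp
  have hQ : 0 ≤ ∫ x in Ioi 0, |u x| ^ 6 := integral_nonneg fun x => by positivity
  have hE : Ehalfline p α u u' < 0 := by
    rw [Ehalfline, h.integral_density hp hp', hT, hP, hAp]
    have hk3 : k ^ (p / 2) * k ^ (3 - p / 2) = k ^ 3 := by
      rw [← Real.rpow_add hk, ← Real.rpow_natCast k 3]; norm_num
    have h1 := mul_lt_mul_of_pos_left hkε (by positivity : 0 < k ^ (p / 2) / k)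
    have e1 : k ^ (p / 2) / k * (k ^ (3 - p / 2) * (μ / 2)) = 1 / 2 * (k ^ 2 * μ) := by
      rw [show k ^ (p / 2) / k * (k ^ (3 - p / 2) * (μ / 2))
        = k ^ (p / 2) * k ^ (3 - p / 2) / k * (μ / 2) by ring, hk3]
      field_simp
    have e2 : k ^ (p / 2) / k * (α / p * ((2 * μ) ^ (p / 2) / p))
        = α / p * ((2 * μ) ^ (p / 2) * k ^ (p / 2) * (1 / (p * k))) := by
      field_simp
    linarith
  exact (csInf_le (bddBelow_Ehalfline hp hp' hα hμ hμR) ⟨u, u', h, hm, rfl⟩).trans_lt hE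

/-- Quadrupling the kinetic term raises the half-line level by a definite amount. -/
lemma exists_gap {p α μ : ℝ} (hp : 2 < p) (hp' : p < 6) (hα : 0 < α) (hμ : 0 < μ)
    (hμR : μ < π * √3 / 4) :
    ∃ δ : ℝ, 0 < δ ∧ glevelHalfline p α μ + δ ≤ 0 ∧
      ∀ u u' : ℝ → ℝ, H1halfline u u' → ∫ x in Ioi 0, u x ^ 2 = μ →
        glevelHalfline p α μ + δ ≤
          ∫ x in Ioi 0, (2 * u' x ^ 2 - 1 / 6 * |u x| ^ 6 - α / p * |u x| ^ p) := by
  have hneg := glevelHalfline_neg hp hp' hα hμ hμR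
  obtain ⟨κ, hκ, hκ1, hGN⟩ := H1halfline.exists_coercive hμ hμR
  have hp0 : 0 < p := by linarith
  set l := glevelHalfline p α μ
  have hl' : 0 < -l := neg_pos.2 hneg
  obtain ⟨R, hR, hRε⟩ := exists_rpow_lt (q := p - 2) (by linarith)
    (by positivity : 0 < -l / (4 * (α / p * μ)))
  rw [lt_div_iff₀ (by positivity)] at hRε
  set D := α / p * R ^ (p - 6) * (3 * κ) with hD
  have hD0 : 0 < D := by positivity
  refine ⟨min (-l / 2) (3 / 8 * (-l / D)), by positivity, ?_, fun u u' h hm => ?_⟩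
  · linarith [min_le_left (-l / 2) (3 / 8 * (-l / D))]
  have hE : l ≤ Ehalfline p α u u' :=
    csInf_le (bddBelow_Ehalfline hp hp' hα hμ hμR) ⟨u, u', h, hm, rfl⟩
  rw [Ehalfline, h.integral_density hp hp'] at hE
  rw [h.integral_density hp hp']
  have hQ := hGN u u' h hm
  have hP := mul_le_mul_of_nonneg_left (h.integral_rpow_le hp hp' hR)
    (by positivity : 0 ≤ α / p)
  have hT : 0 ≤ ∫ x in Ioi 0, u' x ^ 2 := integral_nonneg fun x => sq_nonneg _
  have hQ' := mul_le_mul_of_nonneg_left hQ (by positivity : 0 ≤ α / p * R ^ (p - 6))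
  have hκT := mul_le_mul_of_nonneg_right hκ1.le hT
  rw [hm] at hP
  set T := ∫ x in Ioi 0, u' x ^ 2
  have hDT : α / p * R ^ (p - 6) * (3 * κ * T) = D * T := by rw [hD]; ring
  rcases le_total (D * T) (-l / 4) with hc | hc
  · refine (add_le_add_right (min_le_left _ _) l).trans ?_
    linarith
  · refine (add_le_add_right (min_le_right _ _) l).trans ?_
    have : -l / D ≤ 4 * T := by
      rw [div_le_iff₀ hD0]; linarith
    linarith

namespace H1line

variable {u u' : ℝ → ℝ}

/-- Restriction to a half-line, followed by a dilation (and a reflection if `c < 0`). -/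
lemma h1halfline_comp_affine (h : H1line u u') {c : ℝ} (hc : c ≠ 0) (a : ℝ) :
    H1halfline (fun x => u (c * x + a)) (fun x => c * u' (c * x + a)) := by
  have hd : ∀ x, HasDerivAt (fun x => u (c * x + a)) (c * u' (c * x + a)) x := fun x =>
    ((h.1 (c * x + a)).comp x (((hasDerivAt_id' x).const_mul c).add_const a)).congr_deriv
      (by ring)
  have hi : ∀ f : ℝ → ℝ, Integrable f → IntegrableOn (fun x => f (c * x + a)) (Ioi 0) :=
    fun f hf => ((hf.comp_add_right a).comp_mul_left' hc).integrableOn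
  refine ⟨fun x _ => (hd x).continuousAt.continuousWithinAt, fun x _ => hd x,
    hi _ h.2.1, ?_⟩
  simpa only [mul_pow] using! (hi _ h.2.2).const_mul (c ^ 2)

lemma exists_median (h : H1line u u') (hpos : 0 < ∫ x, u x ^ 2) :
    ∃ a, ∫ x in Ioi a, u x ^ 2 = (∫ x, u x ^ 2) / 2 := by
  have hi := h.2.1
  have hu : Continuous u := continuous_iff_continuousAt.2 fun x => (h.1 x).continuousAt
  set F : ℝ → ℝ := fun a => ∫ x in (0 : ℝ)..a, u x ^ 2 with hF
  have hFc : Continuous F := continuous_iff_continuousAt.2 fun x =>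
    ((hu.pow 2).integral_hasStrictDerivAt 0 x).hasDerivAt.continuousAt
  have hsplit := intervalIntegral.integral_Iic_add_Ioi (b := (0 : ℝ))
    hi.integrableOn hi.integrableOn
  set P := ∫ x in Ioi 0, u x ^ 2
  set N := ∫ x in Iic 0, u x ^ 2
  set m := ∫ x, u x ^ 2
  have t1 : Tendsto F atTop (nhds P) :=
    intervalIntegral_tendsto_integral_Ioi 0 hi.integrableOn tendsto_id
  have t2 : Tendsto F atBot (nhds (-N)) := by
    have := (intervalIntegral_tendsto_integral_Iic (0 : ℝ) hi.integrableOn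
      (tendsto_id (α := ℝ) (x := atBot))).neg
    refine this.congr fun x => ?_
    rw [hF, intervalIntegral.integral_symm]; simp
  obtain ⟨a, ha⟩ := mem_range_of_exists_le_of_exists_ge (c := P - m / 2) hFc
    (t2.eventually_le_const (by linarith)).exists (t1.eventually_const_le (by linarith)).exists
  refine ⟨a, ?_⟩
  have := intervalIntegral.integral_interval_add_Ioi (a := (0 : ℝ)) (b := a)
    hi.integrableOn hi.integrableOn
  simp only [hF] at ha
  linarith

end H1line

lemma integral_Ioi_comp_half_add (f : ℝ → ℝ) (a : ℝ) :
    ∫ x in Ioi 0, f (1 / 2 * x + a) = 2 * ∫ x in Ioi a, f x := by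
  rw [integral_comp_mul_left_Ioi (fun x => f (x + a)) 0 (by norm_num : (0 : ℝ) < 1 / 2),
    mul_zero]
  have := (measurePreserving_add_right volume a).setIntegral_preimage_emb
    (measurableEmbedding_addRight a) f (Ioi a)
  rw [preimage_add_const_Ioi, sub_self] at this
  rw [this]
  simp

lemma integral_Ioi_comp_neg_half_add (f : ℝ → ℝ) (a : ℝ) :
    ∫ x in Ioi 0, f (-(1 / 2) * x + a) = 2 * ∫ x in Iic a, f x := by
  have e : ∀ x : ℝ, f (-(1 / 2) * x + a) = f (-(1 / 2 * x + -a)) := fun x => by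
    congr 1; ring
  simp only [e]
  rw [integral_Ioi_comp_half_add (fun x => f (-x)) (-a), integral_comp_neg_Ioi, neg_neg]

lemma integrable_of_integrableOn_Ioi_comp_neg {f : ℝ → ℝ} (h1 : IntegrableOn f (Ioi 0))
    (h2 : IntegrableOn (fun x => f (-x)) (Ioi 0)) : Integrable f := by
  have h3 := h2.comp_neg
  simp only [neg_neg, Set.neg_Ioi, neg_zero] at h3
  rw [← integrableOn_univ, ← Iic_union_Ioi (a := (0 : ℝ))]
  exact ((integrableOn_Iic_iff_integrableOn_Iio).2 h3).union h1

/-- Strict comparison between the half-line and the line ground state levels: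
for `p ∈ (2,6)`, `α > 0` and `μ ∈ (0, μ_{ℝ⁺})`, `ℰ_α(μ, ℝ⁺) < ℰ_α(μ, ℝ)`. -/
theorem halfline_level_lt_line_level (p α μ : ℝ)
    (hp : 2 < p) (hp' : p < 6) (hα : 0 < α)
    (hμ : 0 < μ) (hμR : μ < Real.pi * Real.sqrt 3 / 4) :
    glevelHalfline p α μ < glevelLine p α μ := by
  obtain ⟨δ, hδ, hδ0, hgap⟩ := exists_gap hp hp' hα hμ hμR
  refine lt_of_lt_of_le (lt_add_of_pos_right _ hδ) (Real.le_sInf ?_ hδ0)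
  rintro _ ⟨u, u', h, hm, rfl⟩
  obtain ⟨a, ha⟩ := h.exists_median (hm ▸ hμ)
  have hsplit := intervalIntegral.integral_Iic_add_Ioi (b := a) h.2.1.integrableOn
    h.2.1.integrableOn
  rw [hm] at hsplit ha
  set f : ℝ → ℝ := fun x => 1 / 2 * (u' x) ^ 2 - 1 / 6 * |u x| ^ 6 - α / p * |u x| ^ p with hf
  have hfi : Integrable f := by
    refine integrable_of_integrableOn_Ioi_comp_neg ?_ ?_
    · simpa [hf] using (h.h1halfline_comp_affine one_ne_zero 0).integrableOn_density hp hp' (1 / 2) α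
    · simpa [hf] using (h.h1halfline_comp_affine (c := -1) (by norm_num) 0).integrableOn_density
        hp hp' (1 / 2) α
  have hr := hgap _ _ (h.h1halfline_comp_affine (c := 1 / 2) (by norm_num) a) (by
    rw [integral_Ioi_comp_half_add (fun x => u x ^ 2)]; linarith)
  have hl := hgap _ _ (h.h1halfline_comp_affine (c := -(1 / 2)) (by norm_num) a) (by
    rw [integral_Ioi_comp_neg_half_add (fun x => u x ^ 2)]; linarith)
  have hr' : ∀ x, 2 * (1 / 2 * u' (1 / 2 * x + a)) ^ 2 - 1 / 6 * |u (1 / 2 * x + a)| ^ 6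
      - α / p * |u (1 / 2 * x + a)| ^ p = f (1 / 2 * x + a) := fun x => by
    simp only [hf]; ring
  have hl' : ∀ x, 2 * (-(1 / 2) * u' (-(1 / 2) * x + a)) ^ 2
      - 1 / 6 * |u (-(1 / 2) * x + a)| ^ 6
      - α / p * |u (-(1 / 2) * x + a)| ^ p = f (-(1 / 2) * x + a) := fun x => by
    simp only [hf]; ring
  simp only [hr', integral_Ioi_comp_half_add f] at hr
  simp only [hl', integral_Ioi_comp_neg_half_add f] at hl
  have hfs := intervalIntegral.integral_Iic_add_Ioi (b := a) hfi.integrableOn hfi.integrableOn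
  have hE : Eline p α u u' = ∫ x, f x := rfl
  linarith
end

section
/- Strict subadditivity of the ground state level on the line: let p ∈ (2,6), α > 0, and let μ₁, μ₂ > 0 satisfy μ₁ + μ₂ < μ_ℝ. Then ℰ_α(μ₁ + μ₂, ℝ) < ℰ_α(μ₁, ℝ) + ℰ_α(μ₂, ℝ). -/
open MeasureTheory Real Set Filter

theorem exists_rpow_le_eps_sixth_add {p ε : ℝ} (hp : 2 < p) (hp' : p < 6) (hε : 0 < ε) :
    ∃ C, 0 ≤ C ∧ ∀ t : ℝ, |t| ^ p ≤ ε * |t| ^ 6 + C * t ^ 2 := by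
  have h6 : 0 < 6 - p := by linarith
  set R : ℝ := ε⁻¹ ^ (6 - p)⁻¹ with hR
  have hR0 : 0 < R := by positivity
  refine ⟨R ^ (p - 2), by positivity, fun t => ?_⟩
  rw [← sq_abs t]
  rcases (abs_nonneg t).eq_or_lt with h0 | h0
  · simp [← h0, (by linarith : p ≠ 0)]
  rcases le_total |t| R with h | h
  · have e : |t| ^ p = |t| ^ (p - 2) * |t| ^ 2 := by
      rw [← rpow_natCast, ← rpow_add h0]; norm_num
    rw [e]
    have : |t| ^ (p - 2) ≤ R ^ (p - 2) := by gcongr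
    have : |t| ^ (p - 2) * |t| ^ 2 ≤ R ^ (p - 2) * |t| ^ 2 := by gcongr
    have : 0 ≤ ε * |t| ^ 6 := by positivity
    linarith
  · have e : |t| ^ 6 = |t| ^ p * |t| ^ (6 - p) := by
      rw [← rpow_natCast, ← rpow_add h0]; norm_num
    have h1 : ε⁻¹ ≤ |t| ^ (6 - p) := by
      calc ε⁻¹ = R ^ (6 - p) := by
            rw [hR, ← rpow_mul (by positivity), inv_mul_cancel₀ h6.ne', rpow_one]
        _ ≤ _ := by gcongr
    have h2 : 1 ≤ ε * |t| ^ (6 - p) := by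
      rw [inv_le_iff_one_le_mul₀ hε] at h1; linarith
    have h3 : |t| ^ p * 1 ≤ |t| ^ p * (ε * |t| ^ (6 - p)) := by gcongr
    have : 0 ≤ R ^ (p - 2) * |t| ^ 2 := by positivity
    rw [e]; linarith

theorem exists_rpow_le_eps_sq_add {p ε : ℝ} (hp : 2 < p) (hp' : p < 6) (hε : 0 < ε) :
    ∃ C, 0 ≤ C ∧ ∀ t : ℝ, |t| ^ p ≤ ε * t ^ 2 + C * |t| ^ 6 := by
  have h2 : 0 < p - 2 := by linarith
  set R : ℝ := ε ^ (p - 2)⁻¹ with hR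
  have hR0 : 0 < R := by positivity
  refine ⟨(R ^ (6 - p))⁻¹, by positivity, fun t => ?_⟩
  rw [← sq_abs t]
  rcases (abs_nonneg t).eq_or_lt with h0 | h0
  · simp [← h0, (by linarith : p ≠ 0)]
  rcases le_total |t| R with h | h
  · have e : |t| ^ p = |t| ^ (p - 2) * |t| ^ 2 := by
      rw [← rpow_natCast, ← rpow_add h0]; norm_num
    rw [e]
    have h1 : |t| ^ (p - 2) ≤ ε :=
      calc |t| ^ (p - 2) ≤ R ^ (p - 2) := by gcongr
        _ = ε := by rw [hR, ← rpow_mul hε.le, inv_mul_cancel₀ h2.ne', rpow_one]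
    have : |t| ^ (p - 2) * |t| ^ 2 ≤ ε * |t| ^ 2 := by gcongr
    have : 0 ≤ (R ^ (6 - p))⁻¹ * |t| ^ 6 := by positivity
    linarith
  · have e : |t| ^ 6 = |t| ^ p * |t| ^ (6 - p) := by
      rw [← rpow_natCast, ← rpow_add h0]; norm_num
    have h1 : R ^ (6 - p) ≤ |t| ^ (6 - p) := by gcongr
    have h3 : |t| ^ p ≤ (R ^ (6 - p))⁻¹ * (|t| ^ p * |t| ^ (6 - p)) := by
      rw [← div_eq_inv_mul, le_div_iff₀ (by positivity)]
      gcongr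
    have : 0 ≤ ε * |t| ^ 2 := by positivity
    rw [e]; linarith

namespace H1line

variable {u u' : ℝ → ℝ}

theorem continuous (h : H1line u u') : Continuous u :=
  continuous_iff_continuousAt.2 fun x => (h.1 x).continuousAt

theorem measurable_deriv (h : H1line u u') : Measurable u' := by
  have : u' = deriv u := funext fun x => (h.1 x).deriv.symm
  rw [this]
  exact _root_.measurable_deriv u

theorem integrable_mul (h : H1line u u') : Integrable fun x => u x * u' x := by
  refine (h.2.1.add h.2.2).mono'
    (h.continuous.measurable.mul h.measurable_deriv).aestronglyMeasurable (ae_of_all _ fun x => ?_)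
  simp only [norm_mul, norm_eq_abs, Pi.add_apply]
  nlinarith [sq_nonneg (|u x| - |u' x|), sq_abs (u x), sq_abs (u' x)]

theorem hasDerivAt_sq (h : H1line u u') (x : ℝ) :
    HasDerivAt (fun x => u x ^ 2) (2 * (u x * u' x)) x := by
  refine ((h.1 x).pow 2).congr_deriv ?_
  push_cast; ring

theorem tendsto_sq_atTop (h : H1line u u') : Tendsto (fun x => u x ^ 2) atTop (nhds 0) :=
  tendsto_zero_of_hasDerivAt_of_integrableOn_Ioi (a := 0) (fun x _ => h.hasDerivAt_sq x)
    (h.integrable_mul.const_mul 2).integrableOn h.2.1.integrableOn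

theorem tendsto_sq_atBot (h : H1line u u') : Tendsto (fun x => u x ^ 2) atBot (nhds 0) :=
  tendsto_zero_of_hasDerivAt_of_integrableOn_Iic (a := 0) (fun x _ => h.hasDerivAt_sq x)
    (h.integrable_mul.const_mul 2).integrableOn h.2.1.integrableOn

theorem exists_sq_le (h : H1line u u') : ∃ M, 0 ≤ M ∧ ∀ x, u x ^ 2 ≤ M := by
  have hi := h.integrable_mul.const_mul 2
  refine ⟨∫ x, ‖2 * (u x * u' x)‖, integral_nonneg fun _ => norm_nonneg _, fun x => ?_⟩
  have key := integral_Iic_of_hasDerivAt_of_tendsto (a := x)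
    (h.hasDerivAt_sq x).continuousAt.continuousWithinAt
    (fun x _ => h.hasDerivAt_sq x) hi.integrableOn h.tendsto_sq_atBot
  rw [sub_zero] at key
  rw [← key]
  refine (le_norm_self _).trans ((norm_integral_le_integral_norm _).trans ?_)
  exact setIntegral_le_integral hi.norm (ae_of_all _ fun _ => norm_nonneg _)

theorem integrable_sixth (h : H1line u u') : Integrable fun x => |u x| ^ 6 := by
  obtain ⟨M, hM, hb⟩ := h.exists_sq_le
  refine (h.2.1.const_mul (M ^ 2)).mono'
    (h.continuous.abs.pow 6).aestronglyMeasurable (ae_of_all _ fun x => ?_)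
  have : |u x| ^ 6 = (u x ^ 2) ^ 2 * u x ^ 2 := by rw [← sq_abs (u x)]; ring
  rw [norm_of_nonneg (by positivity), this]
  have := hb x
  gcongr

theorem integrable_rpow (h : H1line u u') {p : ℝ} (hp : 2 < p) (hp' : p < 6) :
    Integrable fun x => |u x| ^ p := by
  obtain ⟨C, -, hC⟩ := exists_rpow_le_eps_sq_add hp hp' one_pos
  refine ((h.2.1.const_mul 1).add (h.integrable_sixth.const_mul C)).mono'
    (h.continuous.abs.rpow_const fun _ => Or.inr (by linarith)).aestronglyMeasurable
    (ae_of_all _ fun x => ?_)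
  rw [norm_of_nonneg (by positivity)]
  exact hC _

theorem Eline_eq (h : H1line u u') {p : ℝ} (α : ℝ) (hp : 2 < p) (hp' : p < 6) :
    Eline p α u u' = 1 / 2 * (∫ x, u' x ^ 2) - 1 / 6 * (∫ x, |u x| ^ 6)
      - α / p * ∫ x, |u x| ^ p := by
  have i2 := h.2.2.const_mul (1 / 2)
  have i6 := h.integrable_sixth.const_mul (1 / 6)
  have ip := (h.integrable_rpow hp hp').const_mul (α / p)
  have e1 := integral_sub (i2.sub i6) ip
  have e2 := integral_sub i2 i6
  simp only [Pi.sub_apply, integral_const_mul] at e1 e2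
  rw [Eline, e1, e2]

/-- The sharp Gagliardo–Nirenberg inequality on the line, with a strict upper bound `m` on the
mass. -/
theorem sharp_gagliardo_nirenberg (h : H1line u u') {m : ℝ} (hm : ∫ x, u x ^ 2 < m) :
    (π / (2 * m)) ^ 2 * (∫ x, |u x| ^ 6) ≤ ∫ x, u' x ^ 2 := by
  set μ := ∫ x, u x ^ 2 with hμ
  have hμ0 : 0 ≤ μ := integral_nonneg fun _ => sq_nonneg _
  have hm0 : 0 < m := hμ0.trans_lt hm
  set δ := (m - μ) / 2 with hδ
  have hδ0 : 0 < δ := by rw [hδ]; linarith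
  set F : ℝ → ℝ := fun x => ∫ t in Iic x, u t ^ 2 with hF
  have hF0 : ∀ x, 0 ≤ F x := fun x => integral_nonneg fun _ => sq_nonneg _
  have hF1 : ∀ x, F x ≤ μ := fun x =>
    setIntegral_le_integral h.2.1 (ae_of_all _ fun _ => sq_nonneg _)
  have hF' : ∀ x, HasDerivAt F (u x ^ 2) x := by
    intro x
    have e : F = fun y => F 0 + ∫ t in (0 : ℝ)..y, u t ^ 2 := by
      funext y
      rw [← intervalIntegral.integral_Iic_sub_Iic h.2.1.integrableOn h.2.1.integrableOn]
      simp [hF]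
    rw [e]
    exact ((h.continuous.pow 2).integral_hasStrictDerivAt 0 x).hasDerivAt.const_add _
  set c := π / (2 * m) with hc
  have hc0 : 0 < c := by positivity
  set φ : ℝ → ℝ := fun x => 2 * c * (F x + δ) with hφ
  have hφ' : ∀ x, HasDerivAt φ (2 * c * u x ^ 2) x := fun x =>
    ((hF' x).add_const δ).const_mul _
  have hcm : 2 * c * m = π := by rw [hc]; field_simp
  set a := 2 * c * δ with ha
  have ha0 : 0 < a := by positivity
  have hφm : ∀ x, φ x ∈ Icc a (π - a) := by
    intro x
    have : π - a = 2 * c * (μ + δ) := by rw [← hcm, ha, hδ]; ring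
    rw [this]
    constructor
    · simp only [hφ, ha]
      have := hF0 x
      gcongr; linarith
    · simp only [hφ]
      have := hF1 x
      gcongr
  have hsin : ∀ y ∈ Icc a (π - a), sin y ≠ 0 := fun y hy =>
    (sin_pos_of_pos_of_lt_pi (by linarith [hy.1]) (by linarith [hy.2])).ne'
  obtain ⟨K, hK⟩ := isCompact_Icc.exists_bound_of_continuousOn
    (continuous_cos.continuousOn.div continuous_sin.continuousOn hsin)
  set k : ℝ → ℝ := fun x => cos (φ x) / sin (φ x) with hk
  have hkK : ∀ x, |k x| ≤ K := fun x => hK _ (hφm x)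
  have hK0 : 0 ≤ K := (abs_nonneg _).trans (hkK 0)
  have hk' : ∀ x, HasDerivAt k (-(2 * c * u x ^ 2) * (1 + k x ^ 2)) x := by
    intro x
    have hs := hsin _ (hφm x)
    refine (((hφ' x).cos).div ((hφ' x).sin) hs).congr_deriv ?_
    simp only [hk]
    field_simp
    ring
  have hkm : Continuous k := continuous_iff_continuousAt.2 fun x => (hk' x).continuousAt
  set G : ℝ → ℝ := fun x => c / 2 * (u x ^ 2) ^ 2 * k x with hG
  set G' : ℝ → ℝ := fun x => 2 * c * (u x ^ 3 * u' x) * k x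
    - c ^ 2 * |u x| ^ 6 * (1 + k x ^ 2) with hG'def
  have h6 : ∀ x, |u x| ^ 6 = u x ^ 6 := fun x => Even.pow_abs (by decide) _
  have hG' : ∀ x, HasDerivAt G (G' x) x := by
    intro x
    refine ((((h.hasDerivAt_sq x).pow 2).const_mul (c / 2)).mul (hk' x)).congr_deriv ?_
    simp only [hG'def, h6, Pi.pow_apply]
    push_cast
    ring
  obtain ⟨M, hM, hb⟩ := h.exists_sq_le
  have hGi : Integrable G' := by
    refine Integrable.mono' (g := fun x => 2 * c * M * K * ‖u x * u' x‖
      + c ^ 2 * (1 + K ^ 2) * |u x| ^ 6)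
      ((h.integrable_mul.norm.const_mul _).add (h.integrable_sixth.const_mul _)) ?_ ?_
    · have := h.measurable_deriv
      have := h.continuous.measurable
      have := hkm.measurable
      exact Measurable.aestronglyMeasurable (by fun_prop)
    · refine ae_of_all _ fun x => (norm_sub_le _ _).trans (add_le_add ?_ ?_)
      · have e : 2 * c * (u x ^ 3 * u' x) * k x = 2 * c * u x ^ 2 * k x * (u x * u' x) := by ring
        rw [e, norm_mul]
        gcongr
        rw [norm_mul, norm_of_nonneg (by positivity : 0 ≤ 2 * c * u x ^ 2)]
        have := hb x
        have := hkK x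
        gcongr
        exact this
      · rw [norm_of_nonneg (by positivity)]
        have : k x ^ 2 ≤ K ^ 2 := sq_le_sq' (abs_le.1 (hkK x)).1 (abs_le.1 (hkK x)).2
        have e : c ^ 2 * |u x| ^ 6 * (1 + k x ^ 2) = c ^ 2 * (1 + k x ^ 2) * |u x| ^ 6 := by ring
        rw [e]
        gcongr
  have hlim : ∀ l : Filter ℝ, Tendsto (fun x => u x ^ 2) l (nhds 0) → Tendsto G l (nhds 0) := by
    intro l hl
    refine squeeze_zero_norm (a := fun x => c / 2 * (u x ^ 2) ^ 2 * K) (fun x => ?_) ?_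
    · rw [norm_mul, norm_of_nonneg (by positivity : 0 ≤ c / 2 * (u x ^ 2) ^ 2)]
      have := hkK x
      gcongr
      exact this
    · simpa using ((hl.pow 2).const_mul (c / 2)).mul_const K
  have hint := integral_of_hasDerivAt_of_tendsto hG' hGi
    (hlim _ h.tendsto_sq_atBot) (hlim _ h.tendsto_sq_atTop)
  have hnn : 0 ≤ ∫ x, (u' x ^ 2 - G' x - c ^ 2 * |u x| ^ 6) := by
    refine integral_nonneg fun x => ?_
    have : u' x ^ 2 - G' x - c ^ 2 * |u x| ^ 6 = (u' x - c * u x ^ 3 * k x) ^ 2 := by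
      simp only [hG'def, h6]; ring
    simp only [this]
    exact sq_nonneg _
  have e1 := integral_sub (h.2.2.sub hGi) (h.integrable_sixth.const_mul (c ^ 2))
  have e2 := integral_sub h.2.2 hGi
  simp only [Pi.sub_apply, integral_const_mul] at e1 e2
  rw [e1, e2, hint] at hnn
  linarith

theorem scale (h : H1line u u') {s k : ℝ} (hk : 0 < k) :
    H1line (fun x => s * u (k * x)) (fun x => s * k * u' (k * x)) := by
  refine ⟨fun x => ?_, ?_, ?_⟩
  · refine (((h.1 (k * x)).comp x ((hasDerivAt_id x).const_mul k)).const_mul s).congr_deriv ?_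
    ring
  · simp only [mul_pow]
    exact (h.2.1.comp_mul_left' hk.ne').const_mul _
  · simp only [mul_pow]
    exact (h.2.2.comp_mul_left' hk.ne').const_mul _

theorem mass_scale {s k : ℝ} (hk : 0 < k) :
    ∫ x, (s * u (k * x)) ^ 2 = s ^ 2 / k * ∫ x, u x ^ 2 := by
  simp only [mul_pow]
  rw [integral_const_mul, Measure.integral_comp_mul_left (fun x => u x ^ 2),
    abs_of_pos (by positivity)]
  simp only [smul_eq_mul]; ring

theorem Eline_scale (h : H1line u u') {p : ℝ} (α : ℝ) (hp : 2 < p) (hp' : p < 6)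
    {s k : ℝ} (hs : 0 < s) (hk : 0 < k) :
    Eline p α (fun x => s * u (k * x)) (fun x => s * k * u' (k * x)) =
      s ^ 2 * k / 2 * (∫ x, u' x ^ 2) - s ^ 6 / (6 * k) * (∫ x, |u x| ^ 6)
      - α / p * (s ^ p / k * ∫ x, |u x| ^ p) := by
  rw [(h.scale hk).Eline_eq α hp hp', mass_scale hk]
  simp only [abs_mul, abs_of_pos hs, mul_rpow hs.le (abs_nonneg _)]
  simp only [mul_pow]
  rw [integral_const_mul, integral_const_mul, Measure.integral_comp_mul_left (fun x => |u x| ^ 6),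
    Measure.integral_comp_mul_left (fun x => |u x| ^ p), abs_of_pos (by positivity)]
  simp only [smul_eq_mul]
  field_simp

end H1line

theorem exists_H1line_mass {μ : ℝ} (hμ : 0 < μ) :
    ∃ u u' : ℝ → ℝ, H1line u u' ∧ ∫ x, u x ^ 2 = μ := by
  set s := √(μ / √π) with hs
  have e : ∀ x : ℝ, exp (-(x ^ 2) / 2) ^ 2 = exp (-1 * x ^ 2) := fun x => by
    rw [← exp_nat_mul]; congr 1; push_cast; ring
  refine ⟨fun x => s * exp (-(x ^ 2) / 2), fun x => s * (-x * exp (-(x ^ 2) / 2)),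
    ⟨fun x => ?_, ?_, ?_⟩, ?_⟩
  · refine ((((((hasDerivAt_id x).pow 2).neg).div_const 2).exp).const_mul s).congr_deriv ?_
    simp
    ring
  · simp only [mul_pow, e]
    exact (integrable_exp_neg_mul_sq one_pos).const_mul _
  · simp only [mul_pow, e, neg_sq]
    refine Integrable.const_mul ?_ _
    simpa using integrable_rpow_mul_exp_neg_mul_sq one_pos (s := 2) (by norm_num)
  · simp only [mul_pow, e]
    rw [integral_const_mul, integral_gaussian, div_one, hs, sq_sqrt (by positivity)]
    field_simp

/-- The set of energies whose infimum is `glevelLine`. -/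
def energySet (p α μ : ℝ) : Set ℝ :=
  {e : ℝ | ∃ u u' : ℝ → ℝ, H1line u u' ∧ (∫ x, (u x) ^ 2) = μ ∧ Eline p α u u' = e}

section

variable {p α μ : ℝ}

theorem energySet_nonempty (p α : ℝ) (hμ : 0 < μ) : (energySet p α μ).Nonempty := by
  obtain ⟨u, u', h, hm⟩ := exists_H1line_mass hμ
  exact ⟨_, u, u', h, hm, rfl⟩

theorem bddBelow_energySet (hp : 2 < p) (hp' : p < 6) (hα : 0 < α) (hμ : 0 < μ)
    (hμ' : μ < π * √3 / 2) : BddBelow (energySet p α μ) := by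
  obtain ⟨m, hm, hm'⟩ := exists_between hμ'
  have hm0 : 0 < m := hμ.trans hm
  have hp0 : 0 < p := by linarith
  set κ := (π / (2 * m)) ^ 2 with hκ
  have hκ3 : 1 / 3 < κ := by
    have h3 : √3 ^ 2 = 3 := sq_sqrt (by norm_num)
    have h1 : m ^ 2 < (π * √3 / 2) ^ 2 := by gcongr
    rw [hκ, div_pow, lt_div_iff₀ (by positivity)]
    nlinarith
  set ε := (1 / 2 * κ - 1 / 6) * p / α with hε
  have hε0 : 0 < ε := by
    have : 0 < 1 / 2 * κ - 1 / 6 := by linarith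
    positivity
  obtain ⟨C, hC0, hC⟩ := exists_rpow_le_eps_sixth_add hp hp' hε0
  refine ⟨-(α / p * (C * μ)), ?_⟩
  rintro _ ⟨u, u', h, hmass, rfl⟩
  have hgn := h.sharp_gagliardo_nirenberg (hmass.trans_lt hm)
  have hint : ∫ x, |u x| ^ p ≤ ε * (∫ x, |u x| ^ 6) + C * μ := by
    have i1 := h.integrable_sixth.const_mul ε
    have i2 := h.2.1.const_mul C
    rw [← hmass, ← integral_const_mul, ← integral_const_mul, ← integral_add i1 i2]
    exact integral_mono (h.integrable_rpow hp hp') (i1.add i2) fun x => hC (u x)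
  rw [h.Eline_eq α hp hp']
  have h1 : α / p * (∫ x, |u x| ^ p) ≤ α / p * (ε * (∫ x, |u x| ^ 6) + C * μ) := by gcongr
  have h2 : α / p * ε = 1 / 2 * κ - 1 / 6 := by rw [hε]; field_simp
  have h3 : α / p * (ε * (∫ x, |u x| ^ 6) + C * μ) =
      (1 / 2 * κ - 1 / 6) * (∫ x, |u x| ^ 6) + α / p * (C * μ) := by rw [← h2]; ring
  linarith

theorem glevelLine_neg (hp : 2 < p) (hp' : p < 6) (hα : 0 < α) (hμ : 0 < μ)
    (hμ' : μ < π * √3 / 2) : glevelLine p α μ < 0 := by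
  obtain ⟨u, u', h, hm⟩ := exists_H1line_mass hμ
  have hp0 : 0 < p := by linarith
  set D := ∫ x, u' x ^ 2
  set B := ∫ x, |u x| ^ p
  have hD : 0 ≤ D := integral_nonneg fun _ => sq_nonneg _
  have h6 : 0 ≤ ∫ x, |u x| ^ 6 := integral_nonneg fun _ => by positivity
  have hB : 0 < B := by
    refine lt_of_le_of_ne (integral_nonneg fun _ => by positivity) fun h0 => hμ.ne ?_
    have := (integral_eq_zero_iff_of_nonneg (fun _ => by positivity)
      (h.integrable_rpow hp hp')).1 h0.symm
    rw [← hm, eq_comm]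
    refine integral_eq_zero_of_ae ?_
    filter_upwards [this] with x hx
    have : |u x| = 0 := (rpow_eq_zero (abs_nonneg _) hp0.ne').1 hx
    simp [abs_eq_zero.1 this]
  have hq : 0 < α / p * B / (D + 1) := by positivity
  set s := (α / p * B / (D + 1)) ^ (6 - p)⁻¹ with hs
  have hs0 : 0 < s := by positivity
  have hs1 : s ^ (6 - p) = α / p * B / (D + 1) := by
    rw [hs, ← rpow_mul hq.le, inv_mul_cancel₀ (by linarith), rpow_one]
  have hs6 : s ^ 6 = s ^ p * (α / p * B / (D + 1)) := by
    rw [← hs1, ← rpow_natCast, ← rpow_add hs0]; norm_num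
  refine csInf_lt_of_lt (bddBelow_energySet hp hp' hα hμ hμ')
    ⟨_, _, h.scale (s := s) (k := s ^ 2) (by positivity), ?_, rfl⟩ ?_
  · rw [H1line.mass_scale (by positivity), hm]; field_simp
  · rw [h.Eline_scale α hp hp' hs0 (by positivity)]
    have h1 : s ^ 2 * s ^ 2 / 2 * D < α / p * (s ^ p / s ^ 2 * B) := by
      have : s ^ 2 * s ^ 2 / 2 * D = s ^ 6 * D / 2 / s ^ 2 := by field_simp
      rw [this, hs6, div_lt_iff₀ (by positivity)]
      have : α / p * (s ^ p / s ^ 2 * B) * s ^ 2 = s ^ p * (α / p * B) := by field_simp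
      rw [this]
      have : s ^ p * (α / p * B / (D + 1)) * D / 2 = s ^ p * (α / p * B) * (D / (2 * (D + 1))) := by
        field_simp
      rw [this]
      refine mul_lt_of_lt_one_right (by positivity) ?_
      rw [div_lt_one (by positivity)]; linarith
    have h2 : 0 ≤ s ^ 6 / (6 * s ^ 2) * ∫ x, |u x| ^ 6 := by positivity
    linarith

/-- Low-energy states have kinetic energy bounded away from zero. -/
theorem exists_kinetic_lower_bound (hp : 2 < p) (hp' : p < 6) (hα : 0 < α) (hμ : 0 < μ)
    {e : ℝ} (he : e < 0) :
    ∃ δ, 0 < δ ∧ ∀ u u' : ℝ → ℝ, H1line u u' → ∫ x, u x ^ 2 = μ → Eline p α u u' ≤ e →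
      δ ≤ ∫ x, u' x ^ 2 := by
  have hp0 : 0 < p := by linarith
  set ε := -e / 2 * p / (α * μ) with hε
  have hε0 : 0 < ε := by
    have : 0 < -e := by linarith
    positivity
  obtain ⟨C, hC0, hC⟩ := exists_rpow_le_eps_sq_add hp hp' hε0
  set κ := (π / (2 * (μ + 1))) ^ 2 with hκ
  have hκ0 : 0 < κ := by positivity
  have hL : 0 < 1 / 6 + α / p * C := by positivity
  refine ⟨κ * (-e / 2 / (1 / 6 + α / p * C)), ?_, fun u u' h hm hE => ?_⟩
  · have : 0 < -e := by linarith
    positivity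
  have hgn := h.sharp_gagliardo_nirenberg (m := μ + 1) (by linarith)
  have hint : ∫ x, |u x| ^ p ≤ ε * μ + C * ∫ x, |u x| ^ 6 := by
    have i1 := h.integrable_sixth.const_mul C
    have i2 := h.2.1.const_mul ε
    rw [← hm, ← integral_const_mul, ← integral_const_mul, ← integral_add i2 i1]
    exact integral_mono (h.integrable_rpow hp hp') (i2.add i1) fun x => hC (u x)
  have h1 : α / p * (∫ x, |u x| ^ p) ≤ α / p * (ε * μ + C * ∫ x, |u x| ^ 6) := by gcongr
  have h2 : α / p * (ε * μ) = -e / 2 := by rw [hε]; field_simp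
  rw [h.Eline_eq α hp hp'] at hE
  have hD : 0 ≤ ∫ x, u' x ^ 2 := integral_nonneg fun _ => sq_nonneg _
  refine le_trans ?_ hgn
  gcongr
  rw [div_le_iff₀ hL]
  linarith

theorem glevelLine_mul_lt (hp : 2 < p) (hp' : p < 6) (hα : 0 < α) (hμ : 0 < μ) {θ : ℝ}
    (hθ : 1 < θ) (hμ' : θ * μ < π * √3 / 2) :
    glevelLine p α (θ * μ) < θ * glevelLine p α μ := by
  have hθ0 : 0 < θ := by linarith
  have hμlt : μ < π * √3 / 2 := lt_of_le_of_lt (by nlinarith) hμ'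
  have hneg := glevelLine_neg hp hp' hα hμ hμlt
  obtain ⟨δ, hδ, hkin⟩ := exists_kinetic_lower_bound hp hp' hα hμ
    (show glevelLine p α μ / 2 < 0 by linarith)
  have hg : 0 < 1 / 2 * (θ - θ⁻¹) := by
    have := inv_lt_one_of_one_lt₀ hθ
    linarith
  set η := 1 / 2 * (θ - θ⁻¹) * δ / θ with hη
  have hη0 : 0 < η := by positivity
  obtain ⟨_, ⟨u, u', h, hm, rfl⟩, hlt⟩ := exists_lt_of_csInf_lt (energySet_nonempty p α hμ)
    (show glevelLine p α μ < min (glevelLine p α μ / 2) (glevelLine p α μ + η) from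
      lt_min (by linarith) (by linarith))
  have hD := hkin u u' h hm (hlt.trans_le (min_le_left _ _)).le
  have hlt' := hlt.trans_le (min_le_right _ _)
  have hk : 0 < θ⁻¹ := by positivity
  refine csInf_lt_of_lt (bddBelow_energySet hp hp' hα (by positivity) hμ')
    ⟨_, _, h.scale (s := 1) hk, ?_, rfl⟩ ?_
  · rw [H1line.mass_scale hk, hm]; simp
  · have hE : Eline p α (fun x => 1 * u (θ⁻¹ * x)) (fun x => 1 * θ⁻¹ * u' (θ⁻¹ * x)) =
        θ * Eline p α u u' - 1 / 2 * (θ - θ⁻¹) * ∫ x, u' x ^ 2 := by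
      rw [h.Eline_scale α hp hp' one_pos hk, h.Eline_eq α hp hp', one_rpow]
      field_simp
      ring
    rw [hE]
    have h1 : θ * Eline p α u u' < θ * (glevelLine p α μ + η) := by gcongr
    have h2 : θ * η = 1 / 2 * (θ - θ⁻¹) * δ := by rw [hη]; field_simp
    have h3 : 1 / 2 * (θ - θ⁻¹) * δ ≤ 1 / 2 * (θ - θ⁻¹) * ∫ x, u' x ^ 2 := by gcongr
    linarith

end

/-- Strict subadditivity of the ground state level on the line: for `p ∈ (2,6)`,
`α > 0` and `μ₁, μ₂ > 0` with `μ₁ + μ₂ < μ_ℝ`, one has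
`ℰ_α(μ₁ + μ₂, ℝ) < ℰ_α(μ₁, ℝ) + ℰ_α(μ₂, ℝ)`. -/
theorem glevel_strict_subadditive_line (p α μ₁ μ₂ : ℝ)
    (hp : 2 < p) (hp' : p < 6) (hα : 0 < α)
    (hμ₁ : 0 < μ₁) (hμ₂ : 0 < μ₂)
    (hsum : μ₁ + μ₂ < Real.pi * Real.sqrt 3 / 2) :
    glevelLine p α (μ₁ + μ₂) < glevelLine p α μ₁ + glevelLine p α μ₂ := by
  have key : ∀ ν, 0 < ν → ν < μ₁ + μ₂ →
      ν / (μ₁ + μ₂) * glevelLine p α (μ₁ + μ₂) < glevelLine p α ν := by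
    intro ν hν hlt
    have e : (μ₁ + μ₂) / ν * ν = μ₁ + μ₂ := by field_simp
    have := glevelLine_mul_lt hp hp' hα hν ((one_lt_div hν).2 hlt) (by rwa [e])
    rw [e] at this
    calc ν / (μ₁ + μ₂) * glevelLine p α (μ₁ + μ₂)
        < ν / (μ₁ + μ₂) * ((μ₁ + μ₂) / ν * glevelLine p α ν) := by gcongr
      _ = glevelLine p α ν := by field_simp
  have h1 := key μ₁ hμ₁ (by linarith)
  have h2 := key μ₂ hμ₂ (by linarith)
  calc glevelLine p α (μ₁ + μ₂) = μ₁ / (μ₁ + μ₂) * glevelLine p α (μ₁ + μ₂)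
        + μ₂ / (μ₁ + μ₂) * glevelLine p α (μ₁ + μ₂) := by field_simp
    _ < _ := add_lt_add h1 h2
end
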